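/- arXiv:2306.05253 — 10 statements merged into one kernel-verified Lean document; each statement's English description precedes it below -/
import Mathlib

section
/- Let T̄ = (X̄, Ē) be a finite tree with n vertices whose set of leaves (vertices of degree 1) is B̄, with |B̄| = m. Let G = (X, E) be any finite connected simple graph with |X| = n, together with a subset B ⊆ X with |B| = m such that every vertex of B has degree 1 in G. If there exists a bijection σ : B → B̄ such that d_G(b₁, b₂) = d_{T̄}(σ(b₁), σ(b₂)) for all b₁, b₂ ∈ B, then G is isomorphic to T̄. -/
namespace SimpleGraph

variable {V : Type*} {G : SimpleGraph V}

/-- Every distance between `0` and `G.dist u v` is attained along a geodesic from `u` to `v`. -/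
theorem Connected.exists_dist_add_dist_eq (hG : G.Connected) (u v : V) {k : ℕ}
    (hk : k ≤ G.dist u v) : ∃ w, G.dist u w = k ∧ k + G.dist w v = G.dist u v := by
  obtain ⟨p, hp⟩ := hG.exists_walk_length_eq_dist u v
  refine ⟨p.getVert k, ?_⟩
  have h₁ := dist_le (p.take k)
  have h₂ := dist_le (p.drop k)
  have h₃ := hG.dist_triangle (u := u) (v := p.getVert k) (w := v)
  rw [Walk.take_length] at h₁
  rw [Walk.drop_length] at h₂
  omega

/-- A vertex `u ≠ v` has a neighbor that is closer to `v`. -/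
theorem Connected.exists_adj_dist_add_one_eq (hG : G.Connected) {u v : V} (huv : u ≠ v) :
    ∃ w, G.Adj u w ∧ G.dist v w + 1 = G.dist v u := by
  obtain ⟨w, hw, h⟩ := hG.exists_dist_add_dist_eq u v (hG.pos_dist_of_ne huv)
  refine ⟨w, dist_eq_one_iff_adj.mp hw, ?_⟩
  rw [dist_comm (u := v) (v := w), dist_comm (u := v) (v := u)]
  omega

/-- A vertex lying on a geodesic splits it. -/
theorem Walk.dist_add_dist_le_of_mem_support {u v w : V} (p : G.Walk u v)
    (hp : p.length = G.dist u v) (hw : w ∈ p.support) :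
    G.dist u w + G.dist w v ≤ G.dist u v := by
  obtain ⟨q, r, rfl⟩ := Walk.mem_support_iff_exists_append.mp hw
  rw [Walk.length_append] at hp
  exact hp ▸ Nat.add_le_add (dist_le q) (dist_le r)

/-- The distances in a tree from a vertex to two adjacent vertices differ by exactly one. -/
theorem IsTree.dist_eq_add_one_or (hG : G.IsTree) (u : V) {v w : V} (h : G.Adj v w) :
    G.dist u w = G.dist u v + 1 ∨ G.dist u w + 1 = G.dist u v := by
  have := hG.dist_ne_of_adj u h
  have := h.diff_dist_adj (u := u)
  omega

/-- If the edge `vw` of a tree leads from `v` towards `a` and away from `b`, then `v` lies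
between `a` and `b`. -/
theorem IsTree.dist_add_dist_le_of_adj (hG : G.IsTree) {v w a b : V} (h : G.Adj v w)
    (ha : G.dist a w < G.dist a v) (hb : G.dist b v < G.dist b w) :
    G.dist a v + G.dist v b ≤ G.dist a b := by
  have hmem := isBridge_iff_forall_walk_mem_edges.mp
    (isAcyclic_iff_forall_adj_isBridge.mp hG.isAcyclic h)
  obtain ⟨p, hp⟩ := hG.connected.exists_walk_length_eq_dist a b
  obtain ⟨q, hq⟩ := hG.connected.exists_walk_length_eq_dist a w
  obtain ⟨r, hr⟩ := hG.connected.exists_walk_length_eq_dist b v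
  apply p.dist_add_dist_le_of_mem_support hp
  have he := hmem (r.reverse.append (p.reverse.append q))
  rw [Walk.edges_append, Walk.edges_append, Walk.edges_reverse, Walk.edges_reverse,
    List.mem_append, List.mem_append, List.mem_reverse, List.mem_reverse] at he
  rcases he with he | he | he
  · have := r.dist_add_dist_le_of_mem_support hr (r.snd_mem_support_of_mem_edges he)
    omega
  · exact p.fst_mem_support_of_mem_edges he
  · have := q.dist_add_dist_le_of_mem_support hq (q.fst_mem_support_of_mem_edges he)
    omega

/-- **Helly property of balls in a tree.** Finitely many balls in a tree whose radii are
compatible with the distances of their centers have a common point. -/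
theorem IsTree.exists_forall_dist_le (hG : G.IsTree) {ι : Type*} (s : Finset ι) (c : ι → V)
    (r : ι → ℕ) (h : ∀ i ∈ s, ∀ j ∈ s, G.dist (c i) (c j) ≤ r i + r j) :
    ∃ v, ∀ i ∈ s, G.dist (c i) v ≤ r i := by
  have := hG.connected.nonempty
  let excess : V → ℕ := fun v ↦ ∑ i ∈ s, (G.dist (c i) v - r i)
  obtain ⟨v, hv⟩ : ∃ v, ∀ w, excess v ≤ excess w :=
    ⟨Function.argmin excess, fun w ↦ Function.argmin_le excess w⟩
  refine ⟨v, fun i hi ↦ ?_⟩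
  by_contra! hlt
  obtain ⟨w, hvw, hw⟩ := hG.connected.exists_adj_dist_add_one_eq (u := v) (v := c i)
    fun hne ↦ by simp [← hne] at hlt
  refine (hv w).not_gt (Finset.sum_lt_sum (fun j hj ↦ ?_) ⟨i, hi, by omega⟩)
  rcases hG.dist_eq_add_one_or (c j) hvw with hj' | hj'
  · have := hG.dist_add_dist_le_of_adj hvw (a := c i) (b := c j) (by omega) (by omega)
    have := h i hi j hj
    rw [dist_comm (u := v)] at *
    omega
  · omega

/-- Trees are absolute retracts: a nonexpansive map to a tree extends from a subset of a
finite connected graph to the whole graph. -/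
theorem IsTree.exists_extension_dist_le {W : Type*} [Finite W] {H : SimpleGraph W}
    (hG : G.IsTree) (hH : H.Connected) (B : Set W) (f : B → V)
    (hf : ∀ x y : B, G.dist (f x) (f y) ≤ H.dist x y) :
    ∃ g : W → V, (∀ x : B, g x = f x) ∧ ∀ x y, G.dist (g x) (g y) ≤ H.dist x y := by
  classical
  have := hG.connected.nonempty
  have := Fintype.ofFinite W
  suffices key : ∀ s : Finset W, ∃ g : W → V, (∀ x : B, g x = f x) ∧
      ∀ x ∈ B ∪ s, ∀ y ∈ B ∪ s, G.dist (g x) (g y) ≤ H.dist x y by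
    obtain ⟨g, hgf, hg⟩ := key Finset.univ
    exact ⟨g, hgf, fun x y ↦ hg x (by simp) y (by simp)⟩
  intro s
  induction s using Finset.induction_on with
  | empty =>
    refine ⟨fun x ↦ if hx : x ∈ B then f ⟨x, hx⟩ else Classical.arbitrary V, by simp, ?_⟩
    intro x hx y hy
    simp only [Finset.coe_empty, Set.union_empty] at hx hy
    simpa [hx, hy] using hf ⟨x, hx⟩ ⟨y, hy⟩
  | insert a s _ ih =>
    obtain ⟨g, hgf, hg⟩ := ih
    by_cases ha : a ∈ B
    · refine ⟨g, hgf, ?_⟩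
      rwa [Finset.coe_insert, Set.union_insert, Set.insert_eq_of_mem (Set.mem_union_left _ ha)]
    · obtain ⟨v, hv⟩ := hG.exists_forall_dist_le {x | x ∈ B ∪ s} g (H.dist · a)
        fun x hx y hy ↦ (hg x (by simpa using hx) y (by simpa using hy)).trans
          (by rw [dist_comm (u := y)]; exact hH.dist_triangle)
      replace hv : ∀ x ∈ B ∪ s, G.dist (g x) v ≤ H.dist x a :=
        fun x hx ↦ hv x (by simpa using hx)
      refine ⟨Function.update g a v, fun x ↦ ?_, fun x hx y hy ↦ ?_⟩
      · rw [Function.update_of_ne (ne_of_mem_of_not_mem x.2 ha), hgf]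
      · rw [Finset.coe_insert, Set.union_insert, Set.mem_insert_iff] at hx hy
        by_cases hxa : x = a <;> by_cases hya : y = a
        · simp [hxa, hya]
        · subst hxa
          rw [Function.update_self, Function.update_of_ne hya, dist_comm, dist_comm (u := x)]
          exact hv y (hy.resolve_left hya)
        · subst hya
          rw [Function.update_self, Function.update_of_ne hxa]
          exact hv x (hx.resolve_left hxa)
        · rw [Function.update_of_ne hxa, Function.update_of_ne hya]
          exact hg x (hx.resolve_left hxa) y (hy.resolve_left hya)

/-- In a tree, a vertex that is not a leaf has a neighbor farther away from a given vertex. -/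
theorem IsTree.exists_adj_dist_eq_add_one [Fintype V] [DecidableRel G.Adj] [Nontrivial V]
    (hG : G.IsTree) {v : V} (hv : G.degree v ≠ 1) (u : V) :
    ∃ w, G.Adj v w ∧ G.dist u w = G.dist u v + 1 := by
  have hpos := hG.connected.preconnected.degree_pos_of_nontrivial v
  obtain ⟨w₁, h₁, w₂, h₂, hne⟩ := Finset.one_lt_card.mp
    (show 1 < (G.neighborFinset v).card by rw [card_neighborFinset_eq_degree]; omega)
  rw [mem_neighborFinset] at h₁ h₂
  rcases hG.dist_eq_add_one_or u h₁ with hw₁ | hw₁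
  · exact ⟨w₁, h₁, hw₁⟩
  rcases hG.dist_eq_add_one_or u h₂ with hw₂ | hw₂
  · exact ⟨w₂, h₂, hw₂⟩
  have hd₂ : G.dist w₂ v = 1 := dist_eq_one_iff_adj.mpr h₂.symm
  have := hG.connected.pos_dist_of_ne hne.symm
  have := hG.dist_ne_of_adj w₂ h₁
  have := hG.dist_add_dist_le_of_adj h₁ (a := u) (b := w₂) (by omega) (by omega)
  omega

/-- Every vertex of a finite nontrivial tree lies between two leaves. -/
theorem IsTree.exists_leaves_dist_add_dist_eq [Fintype V] [DecidableRel G.Adj] [Nontrivial V]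
    (hG : G.IsTree) (v : V) : ∃ a b, G.degree a = 1 ∧ G.degree b = 1 ∧
      G.dist a v + G.dist v b = G.dist a b := by
  classical
  obtain ⟨⟨a, b⟩, hab, hmax⟩ := Finset.exists_max_image
    {p : V × V | G.dist p.1 v + G.dist v p.2 = G.dist p.1 p.2} (fun p ↦ G.dist p.1 p.2)
    ⟨(v, v), by simp⟩
  simp only [Finset.mem_filter, Finset.mem_univ, true_and, Prod.forall] at hab hmax
  refine ⟨a, b, ?_, ?_, hab⟩
  · by_contra ha
    obtain ⟨w, haw, hw⟩ := hG.exists_adj_dist_eq_add_one ha b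
    have h₁ : G.dist w b = G.dist a b + 1 := by rw [dist_comm, hw, dist_comm]
    have := hG.connected.dist_triangle (u := w) (v := v) (w := b)
    have := hG.connected.dist_triangle (u := w) (v := a) (w := v)
    have : G.dist w a = 1 := dist_eq_one_iff_adj.mpr haw.symm
    have := hmax w b (by omega)
    omega
  · by_contra hb
    obtain ⟨w, hbw, hw⟩ := hG.exists_adj_dist_eq_add_one hb a
    have := hG.connected.dist_triangle (u := a) (v := v) (w := w)
    have := hG.connected.dist_triangle (u := v) (v := b) (w := w)
    have : G.dist b w = 1 := dist_eq_one_iff_adj.mpr hbw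
    have := hmax a w (by omega)
    omega

/-- A vertex between two vertices of a tree is determined by bounds on its distances to them. -/
theorem IsTree.eq_of_dist_le_of_dist_le (hG : G.IsTree) {a b v w : V}
    (h : G.dist a v + G.dist v b = G.dist a b) (ha : G.dist a w ≤ G.dist a v)
    (hb : G.dist b w ≤ G.dist b v) : w = v := by
  by_contra hne
  obtain ⟨z, hvz, hz⟩ := hG.connected.exists_adj_dist_add_one_eq (Ne.symm hne)
  have hpos := hG.connected.pos_dist_of_ne hne
  have closer : ∀ c, G.dist c w ≤ G.dist c v → G.dist c z + 1 = G.dist c v := by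
    intro c hc
    refine (hG.dist_eq_add_one_or c hvz).resolve_left fun hcz ↦ ?_
    have := hG.dist_add_dist_le_of_adj hvz (a := w) (b := c) (by omega) (by omega)
    rw [dist_comm (u := v), dist_comm (u := w) (v := c)] at this
    omega
  have h₁ := closer a ha
  have h₂ := closer b hb
  have := hG.connected.dist_triangle (u := a) (v := z) (w := b)
  rw [dist_comm (u := b), dist_comm (u := b)] at h₂
  omega

/-- An injective homomorphism from a connected graph to a tree reflects adjacency. -/
theorem IsTree.adj_iff_of_injective_hom {W : Type*} {H : SimpleGraph W} (hG : G.IsTree)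
    (hH : H.Connected) (f : H →g G) (hf : Function.Injective f) {x y : W} :
    G.Adj (f x) (f y) ↔ H.Adj x y := by
  refine ⟨fun h ↦ ?_, f.map_adj⟩
  obtain ⟨p⟩ := hH.preconnected x y
  have hmem := isBridge_iff_forall_walk_mem_edges.mp
    (isAcyclic_iff_forall_adj_isBridge.mp hG.isAcyclic h) (p.map f)
  rw [Walk.edges_map, List.mem_map] at hmem
  obtain ⟨e, he, hfe⟩ := hmem
  rw [← Sym2.map_mk, (Sym2.map.injective hf).eq_iff] at hfe
  exact p.adj_of_mem_edges (hfe ▸ he)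

end SimpleGraph


/-- **Boundary rigidity for trees.** Let `T` be a finite tree on vertex set `Y` whose
set of leaves (vertices of degree 1) is `{v // T.degree v = 1}`. Let `G` be any finite
connected simple graph on `X` with `|X| = |Y|`, together with a subset `B ⊆ X` such that
every vertex of `B` has degree 1 in `G`. If there is a bijection `σ` from `B` to the leaf
set of `T` such that `d_G(b₁,b₂) = d_T(σ b₁, σ b₂)` for all `b₁, b₂ ∈ B`, then `G` is
isomorphic to `T`. -/
theorem tree_boundary_rigidity
    {X Y : Type*} [Fintype X] [Fintype Y]
    (T : SimpleGraph Y) [DecidableRel T.Adj] (hT : T.IsTree)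
    (G : SimpleGraph X) [DecidableRel G.Adj] (hG : G.Connected)
    (hcard : Fintype.card X = Fintype.card Y)
    (B : Set X) (hB : ∀ b ∈ B, G.degree b = 1)
    (σ : B ≃ {v : Y // T.degree v = 1})
    (hd : ∀ b₁ b₂ : B, G.dist (b₁ : X) (b₂ : X) = T.dist (σ b₁ : Y) (σ b₂ : Y)) :
    Nonempty (G ≃g T) := by
  obtain ⟨f, hfσ, hf⟩ := hT.exists_extension_dist_le hG B (fun b ↦ (σ b : Y))
    fun b₁ b₂ ↦ (hd b₁ b₂).ge
  have hsurj : Function.Surjective f := by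
    intro y
    rcases subsingleton_or_nontrivial Y with _ | _
    · have := hG.nonempty
      exact ⟨Classical.arbitrary X, Subsingleton.elim _ _⟩
    obtain ⟨l₁, l₂, hl₁, hl₂, hy⟩ := hT.exists_leaves_dist_add_dist_eq y
    obtain ⟨b₁, hb₁⟩ := σ.surjective ⟨l₁, hl₁⟩
    obtain ⟨b₂, hb₂⟩ := σ.surjective ⟨l₂, hl₂⟩
    have hdist := hd b₁ b₂
    have hf₁ := hfσ b₁
    have hf₂ := hfσ b₂
    simp only [hb₁, hb₂] at hdist hf₁ hf₂
    obtain ⟨x, hx₁, hx₂⟩ := hG.exists_dist_add_dist_eq (b₁ : X) b₂ (k := T.dist l₁ y) (by omega)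
    have h₁ := hf b₁ x
    have h₂ := hf b₂ x
    rw [hf₁] at h₁
    rw [hf₂, SimpleGraph.dist_comm (u := (b₂ : X))] at h₂
    refine ⟨x, hT.eq_of_dist_le_of_dist_le hy (by omega) ?_⟩
    rw [SimpleGraph.dist_comm (u := l₂) (v := y)]
    omega
  have hbij : Function.Bijective f :=
    (Fintype.bijective_iff_surjective_and_card f).mpr ⟨hsurj, hcard⟩
  let F : G →g T := ⟨f, fun {x y} h ↦ by
    have hle := hf x y
    rw [SimpleGraph.dist_eq_one_iff_adj.mpr h] at hle
    have hpos := hT.connected.pos_dist_of_ne (hbij.1.ne h.ne)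
    exact SimpleGraph.dist_eq_one_iff_adj.mp (by omega)⟩
  exact ⟨⟨Equiv.ofBijective f hbij, hT.adj_iff_of_injective_hom hG F hbij.1⟩⟩
end

section
/- Let T₁ = (X₁, E₁) and T₂ = (X₂, E₂) be finite trees with leaf sets B₁ and B₂ respectively, with |B₁| = |B₂|, and let d₁, d₂ denote their graph distance functions. If there is a bijection σ : B₁ → B₂ such that d₁(p, q) ≥ d₂(σ(p), σ(q)) for all p, q ∈ B₁, then |X₁| ≥ |X₂|. -/
namespace SimpleGraph

variable {V W : Type*} {G : SimpleGraph V} {H : SimpleGraph W}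

/-- A longest path through a given dart of a forest ends at a leaf. -/
lemma IsAcyclic.degree_eq_one_of_forall_length_le [Fintype V] [DecidableRel G.Adj]
    (hG : G.IsAcyclic) (d : G.Dart) {u v : V} {p : G.Walk u v} (hp : p.IsPath) (hd : d ∈ p.darts)
    (hmax : ∀ (w : V) (q : G.Walk u w), q.IsPath → d ∈ q.darts → q.length ≤ p.length) :
    G.degree v = 1 := by
  have hnil : ¬ p.Nil := by
    intro h
    have := Walk.length_eq_zero_iff.mpr h
    have h2 := List.length_pos_of_mem hd
    simp only [Walk.length_darts] at h2
    omega
  refine degree_eq_one_iff_existsUnique_adj.mpr ⟨p.penultimate, (p.adj_penultimate hnil).symm, ?_⟩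
  intro w hw
  refine hG.eq_penultimate_of_adj_end hp hw ?_
  by_contra hws
  have := hmax w (p.concat hw) (hp.concat hws hw) (by simp [Walk.darts_concat, hd])
  simp at this

/-- Every dart of a finite forest lies on a path between two leaves. -/
lemma IsAcyclic.exists_isPath_between_leaves [Fintype V] [DecidableRel G.Adj]
    (hG : G.IsAcyclic) (d : G.Dart) :
    ∃ (u v : V) (p : G.Walk u v), G.degree u = 1 ∧ G.degree v = 1 ∧ p.IsPath ∧ d ∈ p.darts := by
  let S : Set ℕ := {n | ∃ (u v : V) (p : G.Walk u v), p.IsPath ∧ d ∈ p.darts ∧ p.length = n}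
  have hne : S.Nonempty := ⟨1, d.fst, d.snd, d.adj.toWalk, by simp [d.adj.ne], by simp, by simp⟩
  have hbdd : BddAbove S := by
    refine ⟨Fintype.card V, ?_⟩
    rintro _ ⟨u, v, p, hp, -, rfl⟩
    exact hp.length_lt.le
  obtain ⟨u, v, p, hp, hd, hlen⟩ := Nat.sSup_mem hne hbdd
  have hmax : ∀ (a b : V) (q : G.Walk a b), q.IsPath → d ∈ q.darts → q.length ≤ p.length :=
    fun a b q hq hdq ↦ hlen ▸ le_csSup hbdd ⟨a, b, q, hq, hdq, rfl⟩
  refine ⟨u, v, p, ?_, hG.degree_eq_one_of_forall_length_le d hp hd (hmax u), hp, hd⟩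
  refine hG.degree_eq_one_of_forall_length_le d.symm hp.reverse (by simpa using hd) ?_
  intro w q hq hdq
  simpa using hmax _ _ q.reverse hq.reverse (by simpa using hdq)

/-- A closed walk through all leaves of a finite tree traverses every edge in both directions. -/
lemma IsTree.two_mul_card_le_length_add_two [Fintype V] [DecidableRel G.Adj] (hG : G.IsTree)
    {r : V} (c : G.Walk r r) (hc : ∀ v, G.degree v = 1 → v ∈ c.support) :
    2 * Fintype.card V ≤ c.length + 2 := by
  classical
  have hmem : ∀ d : G.Dart, d ∈ c.darts := by
    intro d
    obtain ⟨u, v, p, hu, hv, hp, hd⟩ := hG.isAcyclic.exists_isPath_between_leaves d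
    have hv' : v ∈ (c.rotate u (hc u hu)).support := by simpa using hc v hv
    have hpq := (hG.isAcyclic.subsingleton_path u v).elim ⟨p, hp⟩
      ((c.rotate u (hc u hu)).takeUntil v hv').toPath
    replace hpq := congrArg Subtype.val hpq
    rw [show p = _ from hpq] at hd
    have hd' := Walk.darts_toPath_subset_darts _ hd
    exact (c.rotate_darts u (hc u hu)).mem_iff.mp (Walk.darts_takeUntil_subset_darts _ _ hd')
  have hcard : Fintype.card G.Dart ≤ c.length := by
    rw [← Walk.length_darts, ← Finset.card_univ]
    refine (Finset.card_le_card fun d _ ↦ ?_).trans c.darts.toFinset_card_le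
    exact List.mem_toFinset.mpr (hmem d)
  have := hG.card_edgeFinset
  rw [dart_card_eq_twice_card_edges] at hcard
  omega

/-- A finite connected graph has a closed walk through all vertices that is no longer than
twice the number of edges of a spanning tree. -/
lemma Connected.exists_closed_walk_length_add_two_le [Fintype V] (hG : G.Connected) (r : V) :
    ∃ c : G.Walk r r, (∀ v, v ∈ c.support) ∧ c.length + 2 ≤ 2 * Fintype.card V := by
  classical
  have hgrow : ∀ k, k + 1 ≤ Fintype.card V →
      ∃ c : G.Walk r r, k + 1 ≤ c.support.toFinset.card ∧ c.length ≤ 2 * k := by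
    intro k
    induction k with
    | zero => exact fun _ ↦ ⟨.nil, by simp, by simp⟩
    | succ k ih =>
      intro hk
      obtain ⟨c, hcard, hlen⟩ := ih (by omega)
      by_cases hall : ∀ v, v ∈ c.support
      · refine ⟨c, ?_, by omega⟩
        rwa [Finset.eq_univ_of_forall fun v ↦ List.mem_toFinset.mpr (hall v), Finset.card_univ]
      push Not at hall
      obtain ⟨w, hw⟩ := hall
      obtain ⟨p⟩ := hG.preconnected r w
      obtain ⟨d, -, hd₁, hd₂⟩ := p.exists_boundary_dart {v | v ∈ c.support} c.start_mem_support hw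
      simp only [Set.mem_ofPred_eq] at hd₁ hd₂
      let c' := (c.takeUntil d.fst hd₁).append
        (.cons d.adj (.cons d.adj.symm (c.dropUntil d.fst hd₁)))
      have hlen' : c'.length = c.length + 2 := by
        have := congrArg Walk.length (c.take_spec hd₁)
        simp only [Walk.length_append] at this
        simp only [c', Walk.length_append, Walk.length_cons]
        omega
      have hsub : insert d.snd c.support.toFinset ⊆ c'.support.toFinset := by
        intro x hx
        simp only [Finset.mem_insert, List.mem_toFinset] at hx ⊢
        rcases hx with rfl | hx
        · simp [c', Walk.mem_support_append_iff]
        · rw [← c.take_spec hd₁, Walk.mem_support_append_iff] at hx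
          simp only [c', Walk.mem_support_append_iff, Walk.support_cons, List.mem_cons]
          tauto
      refine ⟨c', ?_, by omega⟩
      have := Finset.card_le_card hsub
      rw [Finset.card_insert_of_notMem (by simpa using hd₂)] at this
      omega
  have hpos : 0 < Fintype.card V := Fintype.card_pos_iff.mpr ⟨r⟩
  obtain ⟨c, hcard, hlen⟩ := hgrow (Fintype.card V - 1) (by omega)
  refine ⟨c, fun v ↦ ?_, by omega⟩
  have huniv := Finset.eq_univ_of_card c.support.toFinset
    (le_antisymm (Finset.card_le_univ _) (by omega))
  exact List.mem_toFinset.mp (huniv ▸ Finset.mem_univ v)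

/-- A distance-nonincreasing map from a set of vertices of `G` to `H` turns a walk in `G` into a
walk in `H` that visits the images of all vertices of the set visited by the original walk. -/
lemma Walk.exists_walk_of_dist_le (hG : G.Connected) (hH : H.Connected) {B : Set V} (f : B → W)
    (hf : ∀ p q : B, H.dist (f p) (f q) ≤ G.dist p q) {x y : V} (w : G.Walk x y) (p q : B) :
    ∃ w' : H.Walk (f p) (f q), (∀ b : B, (b : V) ∈ w.support → f b ∈ w'.support) ∧
      w'.length ≤ G.dist p x + w.length + G.dist y q := by
  classical
  induction w generalizing p with
  | nil =>
    rename_i x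
    by_cases hx : x ∈ B
    · obtain ⟨a, ha⟩ := hH.exists_walk_length_eq_dist (f p) (f ⟨x, hx⟩)
      obtain ⟨b, hb⟩ := hH.exists_walk_length_eq_dist (f ⟨x, hx⟩) (f q)
      refine ⟨a.append b, ?_, ?_⟩
      · rintro ⟨z, hz⟩ h
        obtain rfl : z = x := by simpa using h
        simp [Walk.mem_support_append_iff]
      · have h₁ : H.dist (f p) (f ⟨x, hx⟩) ≤ G.dist p x := hf p ⟨x, hx⟩
        have h₂ : H.dist (f ⟨x, hx⟩) (f q) ≤ G.dist x q := hf ⟨x, hx⟩ q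
        simp only [Walk.length_append, Walk.length_nil]
        omega
    · obtain ⟨a, ha⟩ := hH.exists_walk_length_eq_dist (f p) (f q)
      refine ⟨a, ?_, ?_⟩
      · rintro ⟨z, hz⟩ h
        obtain rfl : z = x := by simpa using h
        exact absurd hz hx
      · have h₁ := hf p q
        have h₂ : G.dist p q ≤ G.dist p x + G.dist x q := hG.dist_triangle
        simp only [Walk.length_nil]
        omega
  | cons h w ih =>
    rename_i x x' y
    have hxx' : G.dist x x' = 1 := dist_eq_one_iff_adj.mpr h
    by_cases hx : x ∈ B
    · obtain ⟨a, ha⟩ := hH.exists_walk_length_eq_dist (f p) (f ⟨x, hx⟩)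
      obtain ⟨b, hb, hlen⟩ := ih ⟨x, hx⟩
      refine ⟨a.append b, ?_, ?_⟩
      · rintro ⟨z, hz⟩ hzs
        rw [Walk.mem_support_append_iff]
        rw [Walk.support_cons, List.mem_cons] at hzs
        rcases hzs with hzx | hzs
        · obtain rfl : z = x := hzx
          simp
        · exact .inr (hb ⟨z, hz⟩ hzs)
      · have h₁ : H.dist (f p) (f ⟨x, hx⟩) ≤ G.dist p x := hf p ⟨x, hx⟩
        simp only [Walk.length_append, Walk.length_cons] at hlen ⊢
        omega
    · obtain ⟨b, hb, hlen⟩ := ih p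
      refine ⟨b, ?_, ?_⟩
      · rintro ⟨z, hz⟩ hzs
        rw [Walk.support_cons, List.mem_cons] at hzs
        rcases hzs with hzx | hzs
        · obtain rfl : z = x := hzx
          exact absurd hz hx
        · exact hb ⟨z, hz⟩ hzs
      · have h₁ : G.dist p x' ≤ G.dist p x + G.dist x x' := hG.dist_triangle
        simp only [Walk.length_cons]
        omega

end SimpleGraph

/-- Let `T₁`, `T₂` be finite trees with leaf sets `B₁`, `B₂` of equal cardinality.
If there is a bijection `σ : B₁ → B₂` such that `d₁(p,q) ≥ d₂(σ p, σ q)` for all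
leaves `p, q`, then `|X₁| ≥ |X₂|`. -/
theorem tree_leaf_distance_monotone_card
    {X₁ X₂ : Type*} [Fintype X₁] [Fintype X₂]
    (T₁ : SimpleGraph X₁) [DecidableRel T₁.Adj] (hT₁ : T₁.IsTree)
    (T₂ : SimpleGraph X₂) [DecidableRel T₂.Adj] (hT₂ : T₂.IsTree)
    (σ : {v : X₁ // T₁.degree v = 1} ≃ {v : X₂ // T₂.degree v = 1})
    (hd : ∀ p q : {v : X₁ // T₁.degree v = 1},
      T₂.dist (σ p : X₂) (σ q : X₂) ≤ T₁.dist (p : X₁) (q : X₁)) :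
    Fintype.card X₂ ≤ Fintype.card X₁ := by
  rcases isEmpty_or_nonempty {v : X₁ // T₁.degree v = 1} with hB | ⟨⟨r⟩⟩
  · have : Nonempty X₁ := hT₁.connected.nonempty
    rcases subsingleton_or_nontrivial X₂ with _ | _
    · exact (Fintype.card_le_one_iff_subsingleton.mpr ‹_›).trans Fintype.card_pos
    · obtain ⟨v, hv⟩ := hT₂.exists_vert_degree_one_of_nontrivial
      exact hB.elim (σ.symm ⟨v, hv⟩)
  · obtain ⟨c, hc, hlen⟩ := hT₁.connected.exists_closed_walk_length_add_two_le (r : X₁)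
    obtain ⟨c', hc', hlen'⟩ := c.exists_walk_of_dist_le hT₁.connected hT₂.connected
      (B := {v | T₁.degree v = 1}) (fun p ↦ (σ p : X₂)) hd r r
    have := hT₂.two_mul_card_le_length_add_two c' fun v hv ↦ by
      simpa using hc' (σ.symm ⟨v, hv⟩) (hc _)
    simp only [SimpleGraph.dist_self] at hlen'
    omega
end

section
/- Let T₁ = (X₁, E₁) and T₂ = (X₂, E₂) be finite trees with leaf sets B₁ and B₂ respectively, with |B₁| = |B₂|, let d₁, d₂ denote their graph distance functions, and let σ : B₁ → B₂ be a bijection such that d₁(p, q) ≥ d₂(σ(p), σ(q)) for all p, q ∈ B₁. Then |X₁| = |X₂| holds if and only if there is a graph isomorphism from T₁ to T₂ whose restriction to B₁ equals σ. -/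
universe u v

namespace SimpleGraph

variable {V W : Type*}

lemma IsTree.induce_compl_singleton {T : SimpleGraph V} (hT : T.IsTree) {p : V}
    (hp : ∃! w, T.Adj p w) : (T.induce {p}ᶜ).IsTree := by
  obtain ⟨w, hw, huniq⟩ := hp
  have : Nonempty ({p}ᶜ : Set V) := ⟨⟨w, hw.ne'⟩⟩
  refine ⟨⟨hT.connected.preconnected.induce_of_degree_eq_one fun v hv a ha b hb ↦ ?_⟩,
    hT.isAcyclic.induce _⟩
  obtain rfl : v = p := by simpa using hv
  exact (huniq a ha).trans (huniq b hb).symm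

lemma Connected.dist_induce_compl_singleton {G : SimpleGraph V} (hG : G.Connected) {p : V}
    (hp : ∃! w, G.Adj p w) (a b : ({p}ᶜ : Set V)) :
    (G.induce {p}ᶜ).dist a b = G.dist (a : V) b := by
  have hsub : (G.neighborSet p).Subsingleton := fun a ha b hb ↦ hp.unique ha hb
  obtain ⟨q, hq, hlen⟩ := hG.exists_path_of_dist (a : V) b
  have hmem : ∀ x ∈ q.support, x ∈ ({p}ᶜ : Set V) := by
    rintro x hx rfl
    exact hq.isTrail.not_mem_support_of_subsingleton_neighborSet (Ne.symm a.2) (Ne.symm b.2) hsub hx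
  let q' : (G.induce {p}ᶜ).Walk a b := q.induce _ hmem
  apply le_antisymm
  · rw [← hlen]
    exact (dist_le q').trans_eq ((Walk.length_map _ _).symm.trans
      (congrArg Walk.length (q.map_induce hmem)))
  · obtain ⟨r, hr⟩ := q'.reachable.exists_walk_length_eq_dist
    rw [← hr]
    exact (dist_le (r.map (Embedding.induce _).toHom)).trans_eq (Walk.length_map _ _)

lemma Connected.dist_eq_dist_add_one_of_existsUnique_adj {G : SimpleGraph V} (hG : G.Connected)
    {p w x : V} (hw : G.Adj p w) (huniq : ∀ u, G.Adj p u → u = w) (hx : x ≠ p) :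
    G.dist p x = G.dist w x + 1 := by
  apply le_antisymm
  · have := hG.dist_triangle (u := p) (v := w) (w := x)
    rw [dist_eq_one_iff_adj.mpr hw] at this
    lia
  · obtain ⟨q, hq⟩ := hG.exists_walk_length_eq_dist p x
    cases q with
    | nil => exact absurd rfl hx
    | cons h r =>
      obtain rfl := huniq _ h
      rw [← hq, Walk.length_cons]
      exact Nat.succ_le_succ (dist_le r)

lemma existsUnique_adj_of_induce_compl_singleton {G : SimpleGraph V} {l m : V}
    (hl : ∀ u, G.Adj l u → u = m) {v : ({l}ᶜ : Set V)} (hv : ∃! w, (G.induce {l}ᶜ).Adj v w)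
    (hvm : (v : V) ≠ m) : ∃! w, G.Adj v w := by
  obtain ⟨w, hw, huniq⟩ := hv
  refine ⟨w, hw, fun u hu ↦ ?_⟩
  have hul : u ≠ l := by
    rintro rfl
    exact hvm (hl _ hu.symm)
  exact congrArg Subtype.val (huniq ⟨u, hul⟩ hu)

open Classical in
lemma exists_iso_extending_induce_compl_singleton {G : SimpleGraph V} {H : SimpleGraph W}
    {p p' : V} {l l' : W} (hp : G.Adj p p') (hpu : ∀ u, G.Adj p u → u = p')
    (hl : H.Adj l l') (hlu : ∀ u, H.Adj l u → u = l')
    (φ : G.induce {p}ᶜ ≃g H.induce {l}ᶜ) (hφ : φ ⟨p', hp.ne'⟩ = l') :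
    ∃ ψ : G ≃g H, ψ p = l ∧ ∀ x : ({p}ᶜ : Set V), ψ x = φ x := by
  have hφl (x) : (φ x : W) ≠ l := (φ x).2
  have hφp (x) : (φ.symm x : V) ≠ p := (φ.symm x).2
  have hpadj (u) : G.Adj p u ↔ u = p' := ⟨hpu u, fun h ↦ h ▸ hp⟩
  have hladj (u) : H.Adj l u ↔ u = l' := ⟨hlu u, fun h ↦ h ▸ hl⟩
  have hφ' (x) : (φ x : W) = l' ↔ (x : V) = p' := by
    rw [← hφ, Subtype.val_inj, φ.injective.eq_iff, Subtype.ext_iff]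
  have hadj (x y) : H.Adj (φ x) (φ y) ↔ G.Adj x y := φ.map_adj_iff
  let e : V ≃ W :=
    { toFun x := if h : x = p then l else φ ⟨x, h⟩
      invFun y := if h : y = l then p else φ.symm ⟨y, h⟩
      left_inv x := by
        by_cases h : x = p
        · simp [h]
        · simp [h, hφl]
      right_inv y := by
        by_cases h : y = l
        · simp [h]
        · simp [h, hφp] }
  have he : e p = l := by simp [e]
  have he' (x : V) (h : x ≠ p) : e x = φ ⟨x, h⟩ := by simp [e, h]
  refine ⟨⟨e, fun {x y} ↦ ?_⟩, he, fun x ↦ he' x x.2⟩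
  by_cases hx : x = p <;> by_cases hy : y = p
  · subst hx hy; simp
  · rw [hx, he, he' y hy, hladj, hφ', hpadj]
  · rw [hy, he, he' x hx, adj_comm, hladj, hφ', adj_comm, hpadj]
  · rw [he' x hx, he' y hy, hadj]

open Classical in
lemma IsTree.exists_ne_existsUnique_adj [Finite V] [Nontrivial V] {T : SimpleGraph V}
    (hT : T.IsTree) : ∃ u v, u ≠ v ∧ (∃! w, T.Adj u w) ∧ ∃! w, T.Adj v w := by
  have := Fintype.ofFinite V
  obtain ⟨u, v, hne, hu, hv⟩ := hT.exists_ne_and_degree_eq_one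
  exact ⟨u, v, hne, degree_eq_one_iff_existsUnique_adj.mp hu,
    degree_eq_one_iff_existsUnique_adj.mp hv⟩

/-- If a relation `S` between two finite trees does not increase distances and covers every leaf of
the second tree, then the second tree is no larger than the first one, and if both have the same
size then `S` is contained in the graph of an isomorphism. -/
theorem IsTree.card_le_and_exists_iso_of_dist_le {V : Type u} {W : Type v} [Finite V] [Finite W]
    {T : SimpleGraph V} {U : SimpleGraph W} (hT : T.IsTree) (hU : U.IsTree) (S : V → W → Prop)
    (hdist : ∀ ⦃x y x' y'⦄, S x y → S x' y' → U.dist y y' ≤ T.dist x x')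
    (hleaf : ∀ y, (∃! z, U.Adj y z) → ∃ x, S x y) :
    Nat.card W ≤ Nat.card V ∧
      (Nat.card V = Nat.card W → ∃ φ : T ≃g U, ∀ x y, S x y → φ x = y) := by
  induction hn : Nat.card V generalizing V W with
  | zero =>
    have := hT.connected.nonempty
    exact absurd hn Nat.card_pos.ne'
  | succ n ih =>
  have := hT.connected.nonempty
  have := hU.connected.nonempty
  have hfun {x y y'} (h : S x y) (h' : S x y') : y = y' := by
    have := hdist h h'
    rwa [dist_self, Nat.le_zero, hU.connected.dist_eq_zero_iff] at this
  rcases subsingleton_or_nontrivial V with hV | hV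
  · have hW : Subsingleton W := by
      by_contra hW
      rw [not_subsingleton_iff_nontrivial] at hW
      obtain ⟨u, v, hne, hu, hv⟩ := hU.exists_ne_existsUnique_adj
      obtain ⟨x, hx⟩ := hleaf u hu
      obtain ⟨x', hx'⟩ := hleaf v hv
      obtain rfl := Subsingleton.elim x x'
      exact hne (hfun hx hx')
    refine ⟨by rw [Nat.card_of_subsingleton (Classical.arbitrary W)]; lia, fun _ ↦ ?_⟩
    have e : V ≃ W := equivOfSubsingletonOfSubsingleton (fun _ ↦ Classical.arbitrary W)
      fun _ ↦ Classical.arbitrary V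
    refine ⟨⟨e, fun {a b} ↦ ?_⟩, fun x y _ ↦ Subsingleton.elim _ _⟩
    simp [Subsingleton.elim a b]
  obtain ⟨p, -, -, hp, -⟩ := hT.exists_ne_existsUnique_adj
  have hT' := hT.induce_compl_singleton hp
  have hcard : Nat.card ({p}ᶜ : Set V) = n := by
    rw [Nat.card_coe_set_eq, Set.ncard_compl, Set.ncard_singleton]; lia
  have hdT := hT.connected.dist_induce_compl_singleton hp
  by_cases hcov : ∀ y, (∃! z, U.Adj y z) → ∃ x : ({p}ᶜ : Set V), S x y
  · have := (ih hT' hU (fun x y ↦ S x y) (fun x y x' y' h h' ↦ (hdist h h').trans_eq (hdT _ _).symm)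
      hcov hcard).1
    exact ⟨by lia, fun h ↦ by lia⟩
  push Not at hcov
  obtain ⟨l, hl, hlS⟩ := hcov
  have hpl : S p l := by
    obtain ⟨x, hx⟩ := hleaf l hl
    by_cases hxp : x = p
    · rwa [← hxp]
    · exact absurd hx (hlS ⟨x, hxp⟩)
  have hU' := hU.induce_compl_singleton hl
  have hcardW : Nat.card ({l}ᶜ : Set W) + 1 = Nat.card W := by
    have := Nat.card_pos (α := W)
    rw [Nat.card_coe_set_eq, Set.ncard_compl, Set.ncard_singleton]; lia
  have hdU := hU.connected.dist_induce_compl_singleton hl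
  obtain ⟨p', hp', hpu⟩ := hp
  obtain ⟨l', hl', hlu⟩ := hl
  have hmove (x : ({p}ᶜ : Set V)) (y : ({l}ᶜ : Set W)) (h : S x y) :
      U.dist l' y ≤ T.dist p' x := by
    have := hdist hpl h
    rw [hU.connected.dist_eq_dist_add_one_of_existsUnique_adj hl' hlu y.2,
      hT.connected.dist_eq_dist_add_one_of_existsUnique_adj hp' hpu x.2] at this
    lia
  obtain ⟨hle, hiso⟩ := ih hT' hU' (fun x y ↦ S x y ∨ (x : V) = p' ∧ (y : W) = l')
    (by
      rintro x y x' y' (h | ⟨hx, hy⟩) (h' | ⟨hx', hy'⟩) <;> rw [hdT, hdU]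
      · exact hdist h h'
      · rw [hx', hy', dist_comm, T.dist_comm]
        exact hmove _ _ h
      · rw [hx, hy]
        exact hmove _ _ h'
      · simp [hy, hy'])
    (by
      intro y hy
      by_cases hyl : (y : W) = l'
      · exact ⟨⟨p', hp'.ne'⟩, .inr ⟨rfl, hyl⟩⟩
      obtain ⟨x, hx⟩ := hleaf y (existsUnique_adj_of_induce_compl_singleton hlu hy hyl)
      refine ⟨⟨x, ?_⟩, .inl hx⟩
      rintro rfl
      exact y.2 (hfun hx hpl))
    hcard
  refine ⟨by lia, fun h ↦ ?_⟩
  obtain ⟨φ, hφ⟩ := hiso (by lia)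
  obtain ⟨ψ, hψp, hψ⟩ := exists_iso_extending_induce_compl_singleton hp' hpu hl' hlu φ
    (congrArg Subtype.val (hφ ⟨p', hp'.ne'⟩ ⟨l', hl'.ne'⟩ (.inr ⟨rfl, rfl⟩)))
  refine ⟨ψ, fun x y hxy ↦ ?_⟩
  by_cases hx : x = p
  · subst hx
    exact hψp.trans (hfun hpl hxy)
  · have hy : y ≠ l := by
      rintro rfl
      exact hlS ⟨x, hx⟩ hxy
    rw [hψ ⟨x, hx⟩, hφ ⟨x, hx⟩ ⟨y, hy⟩ (.inl hxy)]

end SimpleGraph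


/-- Let `T₁`, `T₂` be finite trees with leaf sets `B₁`, `B₂` of equal cardinality,
and let `σ : B₁ → B₂` be a bijection with `d₁(p,q) ≥ d₂(σ p, σ q)` for all leaves.
Then `|X₁| = |X₂|` holds if and only if there is a graph isomorphism `T₁ ≃g T₂`
whose restriction to `B₁` equals `σ`. -/
theorem tree_leaf_distance_card_eq_iff_iso
    {X₁ X₂ : Type*} [Fintype X₁] [Fintype X₂]
    (T₁ : SimpleGraph X₁) [DecidableRel T₁.Adj] (hT₁ : T₁.IsTree)
    (T₂ : SimpleGraph X₂) [DecidableRel T₂.Adj] (hT₂ : T₂.IsTree)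
    (σ : {v : X₁ // T₁.degree v = 1} ≃ {v : X₂ // T₂.degree v = 1})
    (hd : ∀ p q : {v : X₁ // T₁.degree v = 1},
      T₂.dist (σ p : X₂) (σ q : X₂) ≤ T₁.dist (p : X₁) (q : X₁)) :
    Fintype.card X₁ = Fintype.card X₂ ↔
      ∃ φ : T₁ ≃g T₂, ∀ b : {v : X₁ // T₁.degree v = 1}, φ (b : X₁) = (σ b : X₂) := by
  classical
  refine ⟨fun h ↦ ?_, fun ⟨φ, _⟩ ↦ Fintype.card_congr φ.toEquiv⟩
  obtain ⟨φ, hφ⟩ := (hT₁.card_le_and_exists_iso_of_dist_le hT₂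
    (fun x y ↦ ∃ b : {v : X₁ // T₁.degree v = 1}, (b : X₁) = x ∧ (σ b : X₂) = y)
    (by
      rintro _ _ _ _ ⟨p, rfl, rfl⟩ ⟨q, rfl, rfl⟩
      exact hd p q)
    (fun y hy ↦ by
      have hy' : T₂.degree y = 1 := SimpleGraph.degree_eq_one_iff_existsUnique_adj.mpr hy
      exact ⟨σ.symm ⟨y, hy'⟩, σ.symm ⟨y, hy'⟩, rfl, by simp⟩)).2 (by simpa using h)
  exact ⟨φ, fun b ↦ hφ _ _ ⟨b, rfl, rfl⟩⟩
end

section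
/- Let T₁ = (X₁, E₁) and T₂ = (X₂, E₂) be finite trees with leaf sets B₁ and B₂ respectively, with |B₁| = |B₂|, and let d₁, d₂ denote their graph distance functions. If there is a bijection σ : B₁ → B₂ such that d₁(p, q) = d₂(σ(p), σ(q)) for all p, q ∈ B₁, then there is a graph isomorphism from T₁ to T₂ whose restriction to B₁ equals σ. -/
namespace SimpleGraph

variable {V W : Type*} {G : SimpleGraph V} {H : SimpleGraph W}

theorem Connected.exists_adj_dist_eq_add_one (hG : G.Connected) {x r : V} (h : x ≠ r) :
    ∃ w, G.Adj x w ∧ G.dist r x = G.dist r w + 1 := by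
  obtain ⟨p, hp⟩ := hG.exists_walk_length_eq_dist x r
  cases p with
  | nil => exact absurd rfl h
  | @cons _ w _ hxw p =>
    refine ⟨w, hxw, ?_⟩
    have h1 := dist_le p
    have h2 := hG.dist_triangle (u := x) (v := w) (w := r)
    rw [Walk.length_cons] at hp
    rw [dist_eq_one_iff_adj.mpr hxw] at h2
    rw [dist_comm (u := r), dist_comm (u := r)]
    omega

/-- Every distance up to `G.dist p q` is realised on a geodesic from `p` to `q`. -/
theorem Connected.exists_dist_eq_of_add_eq (hG : G.Connected) {p q : V} {a b : ℕ}
    (h : a + b = G.dist p q) : ∃ y, G.dist p y = a ∧ G.dist y q = b := by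
  induction a generalizing b with
  | zero => exact ⟨p, dist_self, by omega⟩
  | succ a ih =>
    obtain ⟨y, hpy, hyq⟩ := ih (b := b + 1) (by omega)
    have hne : y ≠ q := by
      rintro rfl
      simp at hyq
    obtain ⟨w, hyw, hw⟩ := hG.exists_adj_dist_eq_add_one hne
    rw [dist_comm (u := q), dist_comm (u := q)] at hw
    have h1 := hG.dist_triangle (u := p) (v := y) (w := w)
    have h2 := hG.dist_triangle (u := p) (v := w) (w := q)
    rw [dist_eq_one_iff_adj.mpr hyw] at h1
    exact ⟨w, by omega, by omega⟩

/-- In a tree, a vertex has at most one neighbour closer to a given vertex. -/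
theorem IsTree.eq_of_adj_of_dist_eq_add_one (hG : G.IsTree) {x r w w' : V}
    (hw : G.Adj w r) (hw' : G.Adj w' r)
    (h : G.dist x r = G.dist x w + 1) (h' : G.dist x r = G.dist x w' + 1) : w = w' := by
  obtain ⟨p, hp⟩ := hG.connected.exists_walk_length_eq_dist x w
  obtain ⟨p', hp'⟩ := hG.connected.exists_walk_length_eq_dist x w'
  have hc : (p.concat hw).IsPath := Walk.isPath_of_length_eq_dist _ (by simp [hp, h])
  have hc' : (p'.concat hw').IsPath := Walk.isPath_of_length_eq_dist _ (by simp [hp', h'])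
  have := (hG.existsUnique_path x r).unique hc hc'
  simpa using congrArg Walk.penultimate this

theorem IsTree.dist_eq_of_adj_between (hG : G.IsTree) {u x w r : V} (hxw : G.Adj x w)
    (hr : G.dist r x = G.dist r w + 1) (hu : G.dist u w = G.dist u x + 1) :
    G.dist r u = G.dist r x + G.dist x u := by
  induction hn : G.dist r w generalizing x w with
  | zero =>
    obtain rfl := hG.connected.dist_eq_zero_iff.mp hn
    rw [dist_comm, hu, hr, dist_self, dist_comm (u := u)]
    omega
  | succ n ih =>
    have hne : w ≠ r := by
      rintro rfl
      simp at hn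
    obtain ⟨w', hww', hw'⟩ := hG.connected.exists_adj_dist_eq_add_one hne
    have hu' : G.dist u w' = G.dist u w + 1 := by
      refine (hG.dist_eq_dist_add_one_of_adj u hww').resolve_left fun h ↦ ?_
      have := hG.eq_of_adj_of_dist_eq_add_one hxw hww'.symm hu h
      subst this
      omega
    have := ih hww' hw' hu' (by omega)
    rw [dist_comm (u := w)] at this
    rw [dist_comm (u := x)]
    omega

/-- In a tree, if `x` lies between `u` and `v`, then `x` lies between any vertex `r` and
one of `u`, `v`. -/
theorem IsTree.dist_eq_or_dist_eq_of_dist_add_dist (hG : G.IsTree) {u v x : V}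
    (h : G.dist u x + G.dist x v = G.dist u v) (r : V) :
    G.dist u r = G.dist u x + G.dist x r ∨ G.dist v r = G.dist v x + G.dist x r := by
  by_cases hne : x = r
  · simp [hne]
  obtain ⟨w, hxw, hw⟩ := hG.connected.exists_adj_dist_eq_add_one hne
  have key : ∀ z, G.dist z w = G.dist z x + 1 → G.dist z r = G.dist z x + G.dist x r := by
    intro z hz
    have := hG.dist_eq_of_adj_between hxw hw hz
    rw [dist_comm (u := z), this, dist_comm (u := x), dist_comm (u := x), add_comm]
  rcases hG.dist_eq_dist_add_one_of_adj u hxw with hu | hu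
  · rcases hG.dist_eq_dist_add_one_of_adj v hxw with hv | hv
    · have := hG.connected.dist_triangle (u := u) (v := w) (w := v)
      rw [dist_comm (u := w)] at this
      rw [dist_comm (u := x)] at h
      omega
    · exact .inr (key v hv)
  · exact .inl (key u hu)

/-- In a nontrivial finite tree, every geodesic can be prolonged to end in a leaf. -/
theorem IsTree.exists_degree_eq_one_dist_eq [Fintype V] [Nontrivial V] [DecidableRel G.Adj]
    (hG : G.IsTree) (x y : V) :
    ∃ r, G.degree r = 1 ∧ G.dist x r = G.dist x y + G.dist y r := by
  classical
  obtain ⟨r, hr, hmax⟩ := Finset.exists_max_image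
    (Finset.univ.filter fun r ↦ G.dist x r = G.dist x y + G.dist y r) (G.dist x)
    ⟨y, by simp⟩
  simp only [Finset.mem_filter_univ] at hr hmax
  refine ⟨r, by_contra fun hdeg ↦ ?_, hr⟩
  have hpos := hG.connected.preconnected.degree_pos_of_nontrivial r
  obtain ⟨w, hw, w', hw', hne⟩ := Finset.one_lt_card.mp
    (show 1 < (G.neighborFinset r).card by rw [card_neighborFinset_eq_degree]; omega)
  rw [mem_neighborFinset] at hw hw'
  have key : ∀ z, G.Adj r z → G.dist x r = G.dist x z + 1 := by
    intro z hz
    refine (hG.dist_eq_dist_add_one_of_adj x hz).resolve_right fun h ↦ ?_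
    have h1 := hG.connected.dist_triangle (u := y) (v := r) (w := z)
    have h2 := hG.connected.dist_triangle (u := x) (v := y) (w := z)
    rw [dist_eq_one_iff_adj.mpr hz] at h1
    have := hmax z (by omega)
    omega
  exact hne (hG.eq_of_adj_of_dist_eq_add_one hw.symm hw'.symm (key w hw) (key w' hw'))

section Leaves

variable [Fintype V] [DecidableRel G.Adj]

theorem IsTree.exists_forall_leaf_dist_eq (hG : G.IsTree) (hH : H.IsTree)
    (f : {v : V // G.degree v = 1} → W)
    (hf : ∀ p q : {v : V // G.degree v = 1}, G.dist (p : V) q = H.dist (f p) (f q)) (x : V) :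
    ∃ y, ∀ r : {v : V // G.degree v = 1}, H.dist y (f r) = G.dist x r := by
  rcases subsingleton_or_nontrivial V with hV | hV
  · obtain ⟨y⟩ := hH.connected.nonempty
    refine ⟨y, fun r ↦ ?_⟩
    have := r.2
    simp at this
  obtain ⟨p, hp, -⟩ := hG.exists_degree_eq_one_dist_eq x x
  obtain ⟨q, hq, hpq⟩ := hG.exists_degree_eq_one_dist_eq p x
  obtain ⟨y, hpy, hyq⟩ := hH.connected.exists_dist_eq_of_add_eq
    (hpq.symm.trans (hf ⟨p, hp⟩ ⟨q, hq⟩))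
  refine ⟨y, fun r ↦ ?_⟩
  have h1 := hG.dist_eq_or_dist_eq_of_dist_add_dist hpq.symm r
  have h2 := hH.dist_eq_or_dist_eq_of_dist_add_dist
    (u := f ⟨p, hp⟩) (v := f ⟨q, hq⟩) (x := y) (by rw [← hf, hpy, hyq, hpq]) (f r)
  have h3 := hG.connected.dist_triangle (u := p) (v := x) (w := r)
  have h4 := hG.connected.dist_triangle (u := q) (v := x) (w := r)
  have h5 := hH.connected.dist_triangle (u := f ⟨p, hp⟩) (v := y) (w := f r)
  have h6 := hH.connected.dist_triangle (u := f ⟨q, hq⟩) (v := y) (w := f r)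
  rw [dist_comm, dist_comm (u := x)] at hyq
  simp only [← hf, hpy, hyq] at h2 h5 h6
  omega

theorem IsTree.dist_le_of_forall_leaf_dist_eq (hG : G.IsTree) (hH : H.Connected)
    (f : {v : V // G.degree v = 1} → W) {x x' : V} {y y' : W}
    (h : ∀ r : {v : V // G.degree v = 1}, H.dist y (f r) = G.dist x r)
    (h' : ∀ r : {v : V // G.degree v = 1}, H.dist y' (f r) = G.dist x' r) :
    G.dist x x' ≤ H.dist y y' := by
  rcases subsingleton_or_nontrivial V with hV | hV
  · simp [Subsingleton.elim x x']
  obtain ⟨r, hr, hxr⟩ := hG.exists_degree_eq_one_dist_eq x x'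
  have h1 := hH.dist_triangle (u := y) (v := y') (w := f ⟨r, hr⟩)
  rw [h, h'] at h1
  dsimp only at h1
  omega

end Leaves

end SimpleGraph


/-- **Uniqueness part of the Tree-metric theorem.** Let `T₁`, `T₂` be finite trees with
leaf sets `B₁`, `B₂` of equal cardinality. If there is a bijection `σ : B₁ → B₂` such that
`d₁(p,q) = d₂(σ p, σ q)` for all leaves `p, q`, then there is a graph isomorphism
`T₁ ≃g T₂` whose restriction to `B₁` equals `σ`. -/
theorem tree_metric_uniqueness
    {X₁ X₂ : Type*} [Fintype X₁] [Fintype X₂]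
    (T₁ : SimpleGraph X₁) [DecidableRel T₁.Adj] (hT₁ : T₁.IsTree)
    (T₂ : SimpleGraph X₂) [DecidableRel T₂.Adj] (hT₂ : T₂.IsTree)
    (σ : {v : X₁ // T₁.degree v = 1} ≃ {v : X₂ // T₂.degree v = 1})
    (hd : ∀ p q : {v : X₁ // T₁.degree v = 1},
      T₁.dist (p : X₁) (q : X₁) = T₂.dist (σ p : X₂) (σ q : X₂)) :
    ∃ φ : T₁ ≃g T₂, ∀ b : {v : X₁ // T₁.degree v = 1}, φ (b : X₁) = (σ b : X₂) := by
  have hd' : ∀ p q : {v : X₂ // T₂.degree v = 1},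
      T₂.dist (p : X₂) (q : X₂) = T₁.dist (σ.symm p : X₁) (σ.symm q : X₁) := by
    simp [hd]
  choose φ hφ using hT₁.exists_forall_leaf_dist_eq hT₂ (fun p ↦ (σ p : X₂)) hd
  choose ψ hψ using hT₂.exists_forall_leaf_dist_eq hT₁ (fun p ↦ (σ.symm p : X₁)) hd'
  have hφ' : ∀ x r, T₁.dist x (σ.symm r : X₁) = T₂.dist (φ x) r := fun x r ↦ by
    simpa using (hφ x (σ.symm r)).symm
  have hdist : ∀ x x', T₂.dist (φ x) (φ x') = T₁.dist x x' := fun x x' ↦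
    le_antisymm
      (hT₂.dist_le_of_forall_leaf_dist_eq hT₁.connected (fun p ↦ (σ.symm p : X₁))
        (hφ' x) (hφ' x'))
      (hT₁.dist_le_of_forall_leaf_dist_eq hT₂.connected (fun p ↦ (σ p : X₂)) (hφ x) (hφ x'))
  have hinj : Function.Injective φ := fun x x' h ↦ by
    rw [← hT₁.connected.dist_eq_zero_iff, ← hdist, h, SimpleGraph.dist_self]
  have hsurj : Function.Surjective φ := fun y ↦ ⟨ψ y, by
    have := hT₂.dist_le_of_forall_leaf_dist_eq hT₁.connected (fun p ↦ (σ.symm p : X₁))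
      (hφ' (ψ y)) (hψ y)
    rwa [SimpleGraph.dist_self, Nat.le_zero, hT₂.connected.dist_eq_zero_iff] at this⟩
  refine ⟨⟨.ofBijective φ ⟨hinj, hsurj⟩, fun {x x'} ↦ ?_⟩, fun b ↦ ?_⟩
  · change T₂.Adj (φ x) (φ x') ↔ T₁.Adj x x'
    rw [← SimpleGraph.dist_eq_one_iff_adj, hdist, SimpleGraph.dist_eq_one_iff_adj]
  · have := hφ b b
    rwa [SimpleGraph.dist_self, hT₂.connected.dist_eq_zero_iff] at this
end

section
/- Let T₁ = (X₁, E₁) and T₂ = (X₂, E₂) be finite trees whose leaf sets B₁ and B₂ satisfy |B₁| = |B₂| ≥ 3, let d₁, d₂ denote their graph distance functions, and suppose σ : B₁ → B₂ is a bijection such that d₁(p, q) ≥ d₂(σ(p), σ(q)) for all p, q ∈ B₁. Then there exists a leaf p ∈ B₁ such that |T₁(p)| ≥ |T₂(σ(p))|. -/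
/-- For a tree `T` and a leaf `p`, `|T(p)|` is the distance from `p` to the nearest vertex
of degree at least 3. -/
noncomputable def SimpleGraph.leafBranchDist {X : Type*} [Fintype X]
    (T : SimpleGraph X) [DecidableRel T.Adj] (p : X) : ℕ :=
  sInf {n : ℕ | ∃ y : X, 3 ≤ T.degree y ∧ T.dist p y = n}

namespace SimpleGraph

variable {X : Type*} [Fintype X] {T : SimpleGraph X} [DecidableRel T.Adj]

theorem leafBranchDist_le_dist {p y : X} (hy : 3 ≤ T.degree y) :
    T.leafBranchDist p ≤ T.dist p y :=
  Nat.sInf_le ⟨y, hy, rfl⟩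

theorem exists_dist_eq_leafBranchDist (h : ∃ y, 3 ≤ T.degree y) (p : X) :
    ∃ y, 3 ≤ T.degree y ∧ T.dist p y = T.leafBranchDist p := by
  obtain ⟨y, hy⟩ := h
  exact Nat.sInf_mem (s := {n | ∃ y, 3 ≤ T.degree y ∧ T.dist p y = n}) ⟨_, y, hy, rfl⟩

/-- A nontrivial finite tree has at least two more leaves than branch vertices. -/
theorem IsTree.card_branch_add_two_le_card_leaf [Nontrivial X] (hT : T.IsTree) :
    Fintype.card {v // 3 ≤ T.degree v} + 2 ≤ Fintype.card {v // T.degree v = 1} := by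
  have hsum := T.sum_degrees_eq_twice_card_edges
  have hcard := hT.card_edgeFinset
  have hle : ∑ v : X, (2 + if 3 ≤ T.degree v then 1 else 0) ≤
      ∑ v : X, (T.degree v + if T.degree v = 1 then 1 else 0) := by
    refine Finset.sum_le_sum fun v _ => ?_
    have := hT.connected.preconnected.degree_pos_of_nontrivial v
    split_ifs <;> omega
  simp only [Finset.sum_add_distrib, Finset.sum_boole, Finset.sum_const, Finset.card_univ,
    smul_eq_mul, Nat.cast_id] at hle
  rw [Fintype.card_subtype, Fintype.card_subtype]
  omega

theorem IsTree.exists_three_le_degree (hT : T.IsTree)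
    (h : 3 ≤ Fintype.card {v // T.degree v = 1}) : ∃ y, 3 ≤ T.degree y := by
  by_contra! hlt
  have hsum := T.sum_degrees_eq_twice_card_edges
  have hcard := hT.card_edgeFinset
  have : Nontrivial X := Fintype.one_lt_card_iff_nontrivial.1 <| by
    have := Fintype.card_subtype_le fun v => T.degree v = 1
    omega
  have hle : ∑ v : X, (T.degree v + if T.degree v = 1 then 1 else 0) ≤ ∑ _v : X, 2 := by
    refine Finset.sum_le_sum fun v _ => ?_
    have := hlt v
    split_ifs <;> omega
  simp only [Finset.sum_add_distrib, Finset.sum_boole, Finset.sum_const, Finset.card_univ,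
    smul_eq_mul, Nat.cast_id] at hle
  rw [Fintype.card_subtype] at h
  omega

/-- In a finite tree with at least three leaves, some two leaves share a nearest branch vertex. -/
theorem IsTree.exists_ne_dist_le_leafBranchDist_add (hT : T.IsTree)
    (h : 3 ≤ Fintype.card {v // T.degree v = 1}) :
    ∃ p q : {v // T.degree v = 1}, p ≠ q ∧
      T.dist (p : X) q ≤ T.leafBranchDist (p : X) + T.leafBranchDist (q : X) := by
  have : Nontrivial X := Fintype.one_lt_card_iff_nontrivial.1 <| by
    have := Fintype.card_subtype_le fun v => T.degree v = 1
    omega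
  choose f hf hfd using exists_dist_eq_leafBranchDist (hT.exists_three_le_degree h)
  obtain ⟨p, q, hpq, hfpq⟩ := Fintype.exists_ne_map_eq_of_card_lt
    (fun p : {v // T.degree v = 1} => (⟨f p, hf p⟩ : {v // 3 ≤ T.degree v}))
    (by have := hT.card_branch_add_two_le_card_leaf; omega)
  refine ⟨p, q, hpq, ?_⟩
  have heq : f p = f q := congrArg Subtype.val hfpq
  have htri := hT.connected.dist_triangle (u := (p : X)) (v := f p) (w := q)
  rw [dist_comm (u := f p), hfd p, heq, hfd q] at htri
  exact htri

/-- In a connected graph with a branch vertex, a path joining distinct leaves meets a branch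
vertex. -/
theorem Connected.exists_mem_support_three_le_degree (hT : T.Connected)
    (h : ∃ y, 3 ≤ T.degree y) {p q : X} (hp : T.degree p = 1) (hq : T.degree q = 1)
    (hpq : p ≠ q) {w : T.Walk p q} (hw : w.IsPath) :
    ∃ y ∈ w.support, 3 ≤ T.degree y := by
  by_contra! hlt
  have hnil : ¬ w.Nil := Walk.not_nil_of_ne hpq
  have hclosed : ∀ v ∈ w.support, ∀ u, T.Adj v u → u ∈ w.support := by
    intro v hv u huv
    have hdeg : T.degree v ≤ (w.toSubgraph.neighborSet v).ncard := by
      by_cases hvp : v = p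
      · subst hvp
        rw [hp, hw.neighborSet_toSubgraph_startpoint hnil]
        simp
      by_cases hvq : v = q
      · subst hvq
        rw [hq, hw.neighborSet_toSubgraph_endpoint hnil]
        simp
      obtain ⟨i, rfl, hi⟩ := Walk.mem_support_iff_exists_getVert.1 hv
      have hi0 : i ≠ 0 := by rintro rfl; simp at hvp
      have hil : i ≠ w.length := by rintro rfl; simp at hvq
      rw [hw.ncard_neighborSet_toSubgraph_internal_eq_two hi0 (by omega)]
      have := hlt _ hv
      omega
    have heq : w.toSubgraph.neighborSet v = T.neighborSet v := by
      refine Set.eq_of_subset_of_ncard_le (Subgraph.neighborSet_subset _ v) ?_ (Set.toFinite _)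
      rwa [Set.ncard_eq_toFinset_card', ← neighborFinset_def, card_neighborFinset_eq_degree]
    have hadj : w.toSubgraph.Adj v u := by
      change u ∈ w.toSubgraph.neighborSet v
      rwa [heq]
    exact (w.mem_verts_toSubgraph).1 hadj.snd_mem
  have hall : ∀ {a b : X}, T.Walk a b → a ∈ w.support → b ∈ w.support := by
    intro a b c
    induction c with
    | nil => exact id
    | cons hab _ ih => exact fun ha => ih (hclosed _ ha _ hab)
  obtain ⟨y, hy⟩ := h
  obtain ⟨c⟩ := hT.preconnected p y
  exact (hlt y (hall c w.start_mem_support)).not_ge hy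

theorem Connected.leafBranchDist_add_le_dist (hT : T.Connected)
    (h : ∃ y, 3 ≤ T.degree y) {p q : X} (hp : T.degree p = 1) (hq : T.degree q = 1)
    (hpq : p ≠ q) : T.leafBranchDist p + T.leafBranchDist q ≤ T.dist p q := by
  classical
  obtain ⟨w, hw, hlen⟩ := hT.exists_path_of_dist p q
  obtain ⟨y, hy, hdeg⟩ := hT.exists_mem_support_three_le_degree h hp hq hpq hw
  have h₁ := dist_le (w.takeUntil y hy)
  have h₂ := dist_le (w.dropUntil y hy)
  rw [dist_comm] at h₂
  have h₃ := congrArg Walk.length (w.take_spec hy)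
  rw [Walk.length_append] at h₃
  have h₄ := leafBranchDist_le_dist (p := p) hdeg
  have h₅ := leafBranchDist_le_dist (p := q) hdeg
  omega

end SimpleGraph

/-- **Claim (∗).** Let `T₁`, `T₂` be finite trees whose leaf sets `B₁`, `B₂` satisfy
`|B₁| = |B₂| ≥ 3`, and let `σ : B₁ → B₂` be a bijection with `d₁(p,q) ≥ d₂(σ p, σ q)`
for all leaves. Then there exists a leaf `p ∈ B₁` with `|T₁(p)| ≥ |T₂(σ p)|`. -/
theorem exists_leaf_branchDist_ge
    {X₁ X₂ : Type*} [Fintype X₁] [Fintype X₂]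
    (T₁ : SimpleGraph X₁) [DecidableRel T₁.Adj] (hT₁ : T₁.IsTree)
    (T₂ : SimpleGraph X₂) [DecidableRel T₂.Adj] (hT₂ : T₂.IsTree)
    (hleaf : 3 ≤ Fintype.card {v : X₁ // T₁.degree v = 1})
    (σ : {v : X₁ // T₁.degree v = 1} ≃ {v : X₂ // T₂.degree v = 1})
    (hd : ∀ p q : {v : X₁ // T₁.degree v = 1},
      T₂.dist (σ p : X₂) (σ q : X₂) ≤ T₁.dist (p : X₁) (q : X₁)) :
    ∃ p : {v : X₁ // T₁.degree v = 1},
      T₂.leafBranchDist (σ p : X₂) ≤ T₁.leafBranchDist (p : X₁) := by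
  obtain ⟨p, q, hpq, hle⟩ := hT₁.exists_ne_dist_le_leafBranchDist_add hleaf
  have hbranch := hT₂.exists_three_le_degree (hleaf.trans_eq (Fintype.card_congr σ))
  have hge := hT₂.connected.leafBranchDist_add_le_dist hbranch (σ p).2 (σ q).2
    (Subtype.val_injective.ne (σ.injective.ne hpq))
  have := hd p q
  by_contra! hlt
  have := hlt p
  have := hlt q
  omega
end

section
/- Let T = (X, E) be a finite tree with at least 3 leaves, with leaf set B and graph distance d. For leaves p, q, z ∈ B define the Gromov product (p, q)_z := d(p, z) + d(q, z) − d(p, q). If pairwise distinct leaves p, q, z ∈ B maximize (p, q)_z among all triples of pairwise distinct leaves, then d(p, q) = |T(p)| + |T(q)|. -/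
namespace SimpleGraph

variable {X : Type*} {T : SimpleGraph X}

lemma Connected.exists_adj_dist_eq_add_one_s5 (hT : T.Connected) {a x : X} (hx : x ≠ a) :
    ∃ u, T.Adj x u ∧ T.dist a x = T.dist a u + 1 := by
  obtain ⟨w, hw⟩ := hT.exists_walk_length_eq_dist x a
  cases w with
  | nil => exact absurd rfl hx
  | @cons _ u _ h w =>
    refine ⟨u, h, ?_⟩
    have h1 := dist_le w
    have h2 := hT.dist_triangle (u := x) (v := u) (w := a)
    have h3 := dist_eq_one_iff_adj.mpr h
    rw [Walk.length_cons] at hw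
    rw [dist_comm (u := a), dist_comm (u := a)]
    omega

/-- In a tree, a vertex has at most one neighbour closer to a given vertex `a`. -/
lemma IsTree.eq_of_adj_of_dist_eq_add_one_s5 (hT : T.IsTree) {a x u v : X}
    (hu : T.Adj x u) (hv : T.Adj x v)
    (hdu : T.dist a x = T.dist a u + 1) (hdv : T.dist a x = T.dist a v + 1) : u = v := by
  obtain ⟨wu, hwu⟩ := hT.connected.exists_walk_length_eq_dist u a
  obtain ⟨wv, hwv⟩ := hT.connected.exists_walk_length_eq_dist v a
  have hpu : (Walk.cons hu wu).IsPath := Walk.isPath_of_length_eq_dist _ <| by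
    rw [Walk.length_cons, hwu, dist_comm, ← hdu, dist_comm]
  have hpv : (Walk.cons hv wv).IsPath := Walk.isPath_of_length_eq_dist _ <| by
    rw [Walk.length_cons, hwv, dist_comm, ← hdv, dist_comm]
  simpa using congrArg Walk.snd ((hT.existsUnique_path x a).unique hpu hpv)

/-- If `n` is a neighbour of `y` pointing away from `p`, then every `w` lying beyond `n` is
separated from `p` by `y`. -/
lemma IsTree.dist_eq_add_of_adj (hT : T.IsTree) {p y n : X} (hn : T.Adj y n)
    (hpn : T.dist p n = T.dist p y + 1) {w : X} (hw : T.dist y w = T.dist n w + 1) :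
    T.dist p w = T.dist p y + T.dist y w := by
  induction hk : T.dist n w generalizing w with
  | zero =>
    obtain rfl := hT.connected.dist_eq_zero_iff.mp hk
    rw [hpn, dist_eq_one_iff_adj.mpr hn]
  | succ k ih =>
    have hwn : w ≠ n := by
      rintro rfl
      simp at hk
    obtain ⟨u, hwu, hu⟩ := hT.connected.exists_adj_dist_eq_add_one_s5 hwn
    have hyn := dist_eq_one_iff_adj.mpr hn
    have hyu : T.dist y u = T.dist n u + 1 := by
      have h1 := hT.connected.dist_triangle (u := y) (v := n) (w := u)
      have h2 := hT.connected.dist_triangle (u := y) (v := u) (w := w)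
      have h3 := dist_eq_one_iff_adj.mpr hwu.symm
      omega
    have hpu := ih hyu (by omega)
    rcases hT.dist_eq_dist_add_one_of_adj p hwu with h | h
    · omega
    · have huy : u ≠ y := by
        rintro rfl
        simp at hyu
      obtain ⟨v, huv, hv⟩ := hT.connected.exists_adj_dist_eq_add_one_s5 huy
      have h1 := hT.connected.dist_triangle (u := p) (v := y) (w := v)
      have hpv : T.dist p u = T.dist p v + 1 := by
        rcases hT.dist_eq_dist_add_one_of_adj p huv with h | h <;> omega
      obtain rfl := hT.eq_of_adj_of_dist_eq_add_one_s5 huv hwu.symm hpv h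
      omega

variable [Fintype X] [DecidableRel T.Adj]

/-- In a finite tree, every edge `y n` extends beyond `n` to a leaf. -/
lemma IsTree.exists_degree_eq_one_of_adj (hT : T.IsTree) {y n : X} (hn : T.Adj y n) :
    ∃ w, T.degree w = 1 ∧ T.dist y w = T.dist n w + 1 := by
  obtain ⟨w, hw, hmax⟩ := (Set.toFinite {w | T.dist y w = T.dist n w + 1}).exists_maximalFor
    (T.dist y) _ ⟨n, by simp [dist_eq_one_iff_adj.mpr hn]⟩
  simp only [Set.mem_ofPred_eq] at hw hmax
  refine ⟨w, ?_, hw⟩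
  have hwy : w ≠ y := by
    rintro rfl
    simp at hw
  obtain ⟨u, hwu, -⟩ := hT.connected.exists_adj_dist_eq_add_one_s5 hwy
  have hpos : 0 < T.degree w := (T.degree_pos_iff_exists_adj w).mpr ⟨u, hwu⟩
  by_contra hdeg
  have hcard : 1 < (T.neighborFinset w).card := by
    rw [card_neighborFinset_eq_degree]
    omega
  have hfar : ∀ x, T.Adj w x → T.dist y w = T.dist y x + 1 := by
    intro x hx
    refine (hT.dist_eq_dist_add_one_of_adj y hx).resolve_right fun h => ?_
    have h1 := hT.connected.dist_triangle (u := y) (v := n) (w := x)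
    have h2 := hT.connected.dist_triangle (u := n) (v := w) (w := x)
    have h3 := dist_eq_one_iff_adj.mpr hx
    have h4 := dist_eq_one_iff_adj.mpr hn
    have := hmax (j := x) (by omega) (by omega)
    omega
  obtain ⟨a, ha, b, hb, hab⟩ := Finset.one_lt_card.mp hcard
  rw [mem_neighborFinset] at ha hb
  exact hab (hT.eq_of_adj_of_dist_eq_add_one_s5 ha hb (hfar a ha) (hfar b hb))

/-- A vertex of degree at least 3 has a neighbour pointing away from two given vertices. -/
lemma IsTree.exists_adj_dist_eq_add_one_s5 (hT : T.IsTree) {y : X} (hy : 3 ≤ T.degree y)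
    (p z : X) :
    ∃ n, T.Adj y n ∧ T.dist p n = T.dist p y + 1 ∧ T.dist z n = T.dist z y + 1 := by
  rw [← card_neighborFinset_eq_degree] at hy
  obtain ⟨a, b, c, ha, hb, hc, hab, hac, hbc⟩ := Finset.two_lt_card_iff.mp hy
  rw [mem_neighborFinset] at ha hb hc
  have key : ∀ s {u v}, T.Adj y u → T.Adj y v → u ≠ v →
      T.dist s u = T.dist s y + 1 ∨ T.dist s v = T.dist s y + 1 := by
    intro s u v hu hv huv
    by_contra! h
    exact huv (hT.eq_of_adj_of_dist_eq_add_one_s5 hu hv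
      ((hT.dist_eq_dist_add_one_of_adj s hu).resolve_right h.1)
      ((hT.dist_eq_dist_add_one_of_adj s hv).resolve_right h.2))
  have := key p ha hb hab
  have := key p ha hc hac
  have := key p hb hc hbc
  have := key z ha hb hab
  have := key z ha hc hac
  have := key z hb hc hbc
  grind

/-- Three distinct leaves of a tree have a median, which is a branch vertex. -/
lemma IsTree.exists_median (hT : T.IsTree) {p q z : X}
    (hp : T.degree p = 1) (hq : T.degree q = 1) (hz : T.degree z = 1)
    (hpq : p ≠ q) (hpz : p ≠ z) (hqz : q ≠ z) :
    ∃ m, 3 ≤ T.degree m ∧ T.dist p q = T.dist p m + T.dist m q ∧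
      T.dist p z = T.dist p m + T.dist m z ∧ T.dist q z = T.dist q m + T.dist m z := by
  have : Nonempty X := ⟨p⟩
  obtain ⟨m, hm⟩ := Finite.exists_min fun x => T.dist p x + T.dist q x + T.dist z x
  have hstep : ∀ s {u v}, T.Adj m u → T.Adj m v → T.dist s m = T.dist s u + 1 → u ≠ v →
      T.dist s v = T.dist s m + 1 := fun s u v hu hv hsu huv =>
    (hT.dist_eq_dist_add_one_of_adj s hv).resolve_left fun h =>
      huv (hT.eq_of_adj_of_dist_eq_add_one_s5 hu hv hsu h)
  have hleaf : ∀ {x u v}, T.degree x = 1 → T.Adj x u → T.Adj x v → u = v := by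
    intro x u v hx hu hv
    rw [← card_neighborFinset_eq_degree] at hx
    exact Finset.card_le_one.mp hx.le u (by simpa) v (by simpa)
  have hmp : m ≠ p := by
    rintro rfl
    obtain ⟨u, hu, hqu⟩ := hT.connected.exists_adj_dist_eq_add_one_s5 hpq
    obtain ⟨v, hv, hzv⟩ := hT.connected.exists_adj_dist_eq_add_one_s5 hpz
    obtain rfl := hleaf hp hu hv
    have := hm u
    simp only [dist_self, dist_eq_one_iff_adj.mpr hu] at this
    omega
  have hmq : m ≠ q := by
    rintro rfl
    obtain ⟨u, hu, hqu⟩ := hT.connected.exists_adj_dist_eq_add_one_s5 hpq.symm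
    obtain ⟨v, hv, hzv⟩ := hT.connected.exists_adj_dist_eq_add_one_s5 hqz
    obtain rfl := hleaf hq hu hv
    have := hm u
    simp only [dist_self, dist_eq_one_iff_adj.mpr hu] at this
    omega
  have hmz : m ≠ z := by
    rintro rfl
    obtain ⟨u, hu, hqu⟩ := hT.connected.exists_adj_dist_eq_add_one_s5 hpz.symm
    obtain ⟨v, hv, hzv⟩ := hT.connected.exists_adj_dist_eq_add_one_s5 hqz.symm
    obtain rfl := hleaf hz hu hv
    have := hm u
    simp only [dist_self, dist_eq_one_iff_adj.mpr hu] at this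
    omega
  obtain ⟨a, ha, hpa⟩ := hT.connected.exists_adj_dist_eq_add_one_s5 hmp
  obtain ⟨b, hb, hqb⟩ := hT.connected.exists_adj_dist_eq_add_one_s5 hmq
  obtain ⟨c, hc, hzc⟩ := hT.connected.exists_adj_dist_eq_add_one_s5 hmz
  have hab : a ≠ b := by
    rintro rfl
    have := hm a
    have := hT.dist_eq_dist_add_one_of_adj z ha
    omega
  have hac : a ≠ c := by
    rintro rfl
    have := hm a
    have := hT.dist_eq_dist_add_one_of_adj q ha
    omega
  have hbc : b ≠ c := by
    rintro rfl
    have := hm b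
    have := hT.dist_eq_dist_add_one_of_adj p hb
    omega
  refine ⟨m, ?_, ?_, ?_, ?_⟩
  · rw [← card_neighborFinset_eq_degree]
    exact Finset.two_lt_card_iff.mpr ⟨a, b, c, by simpa, by simpa, by simpa, hab, hac, hbc⟩
  · exact hT.dist_eq_add_of_adj hb (hstep p ha hb hpa hab)
      (by rw [dist_comm, hqb, dist_comm])
  · exact hT.dist_eq_add_of_adj hc (hstep p ha hc hpa hac)
      (by rw [dist_comm, hzc, dist_comm])
  · exact hT.dist_eq_add_of_adj hc (hstep q hb hc hqb hbc)
      (by rw [dist_comm, hzc, dist_comm])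

/-- For every branch vertex `y` there is a leaf `w` for which `y` lies between `w` and each of
`p`, `z`. -/
lemma IsTree.exists_leaf_dist_eq_add (hT : T.IsTree) {y : X} (hy : 3 ≤ T.degree y) (p z : X) :
    ∃ w, T.degree w = 1 ∧ w ≠ y ∧ T.dist p w = T.dist p y + T.dist y w ∧
      T.dist z w = T.dist z y + T.dist y w := by
  obtain ⟨n, hn, hpn, hzn⟩ := hT.exists_adj_dist_eq_add_one_s5 hy p z
  obtain ⟨w, hw, hnw⟩ := hT.exists_degree_eq_one_of_adj hn
  refine ⟨w, hw, ?_, hT.dist_eq_add_of_adj hn hpn hnw, hT.dist_eq_add_of_adj hn hzn hnw⟩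
  rintro rfl
  simp at hnw

/-- If replacing `q` never increases the Gromov product `(p, q)_z`, the median of `p, q, z` is a
branch vertex nearest to `p`. -/
lemma IsTree.leafBranchDist_eq_of_maximizer (hT : T.IsTree) {p q z m : X}
    (hpz : p ≠ z) (hm : 3 ≤ T.degree m)
    (hmpq : T.dist p q = T.dist p m + T.dist m q) (hmpz : T.dist p z = T.dist p m + T.dist m z)
    (hmqz : T.dist q z = T.dist q m + T.dist m z)
    (hmax : ∀ w, T.degree w = 1 → p ≠ w → w ≠ z →
      (T.dist w z : ℤ) - T.dist p w ≤ T.dist q z - T.dist p q) :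
    T.leafBranchDist p = T.dist p m := by
  refine le_antisymm (Nat.sInf_le ⟨m, hm, rfl⟩) (le_csInf ⟨_, m, hm, rfl⟩ ?_)
  rintro _ ⟨y, hy, rfl⟩
  by_contra! hlt
  obtain ⟨w, hw, hwy, hpw, hzw⟩ := hT.exists_leaf_dist_eq_add hy p z
  have hpos := hT.connected.pos_dist_of_ne hwy.symm
  have hp : p ≠ w := by
    rintro rfl
    rw [dist_self] at hpw
    omega
  have hz : w ≠ z := by
    rintro rfl
    rw [dist_self] at hzw
    omega
  have h1 := hmax w hw hp hz
  have h2 := hT.connected.dist_triangle (u := p) (v := y) (w := z)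
  rw [dist_comm (u := w), hpw, hzw, hmqz, hmpq, dist_comm (u := q)] at h1
  rw [dist_comm (u := y)] at h2
  omega

end SimpleGraph

/-- Let `T` be a finite tree with at least 3 leaves and graph distance `d`. For leaves
`p, q, z` define the Gromov product `(p,q)_z := d(p,z) + d(q,z) - d(p,q)`. If pairwise
distinct leaves `p, q, z` maximize `(p,q)_z` among all triples of pairwise distinct
leaves, then `d(p,q) = |T(p)| + |T(q)|`. -/
theorem gromov_product_maximizer_dist_eq
    {X : Type*} [Fintype X]
    (T : SimpleGraph X) [DecidableRel T.Adj] (hT : T.IsTree)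
    (hleaf : 3 ≤ Fintype.card {v : X // T.degree v = 1})
    (gp : X → X → X → ℤ)
    (hgp : ∀ p q z : X, gp p q z
      = (T.dist p z : ℤ) + (T.dist q z : ℤ) - (T.dist p q : ℤ))
    (p q z : X)
    (hp : T.degree p = 1) (hq : T.degree q = 1) (hz : T.degree z = 1)
    (hpq : p ≠ q) (hpz : p ≠ z) (hqz : q ≠ z)
    (hmax : ∀ p' q' z' : X, T.degree p' = 1 → T.degree q' = 1 → T.degree z' = 1 →
      p' ≠ q' → p' ≠ z' → q' ≠ z' → gp p' q' z' ≤ gp p q z) :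
    T.dist p q = T.leafBranchDist p + T.leafBranchDist q := by
  obtain ⟨m, hm, hmpq, hmpz, hmqz⟩ := hT.exists_median hp hq hz hpq hpz hqz
  rw [hT.leafBranchDist_eq_of_maximizer hpz hm hmpq hmpz hmqz,
    hT.leafBranchDist_eq_of_maximizer (q := p) hqz hm
      (by rw [T.dist_comm, hmpq, T.dist_comm (u := p), T.dist_comm (u := m) (v := q), add_comm])
      hmqz hmpz, hmpq, T.dist_comm (u := m)]
  · intro w hw hqw hwz
    have := hmax w q z hw hq hz hqw.symm hwz hqz
    rw [hgp, hgp] at this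
    rw [T.dist_comm (u := q) (v := w), T.dist_comm (u := q) (v := p)]
    omega
  · intro w hw hpw hwz
    have := hmax p w z hp hw hz hpw hpz hwz
    rw [hgp, hgp] at this
    omega
end

section
/- Let T = (X, E) be a finite tree with at least 2 vertices, and let v₁, v₂ ∈ X be distinct vertices that are not adjacent in T. Let G = (X, E ∪ {{v₁, v₂}}) be the simple graph obtained by adding the edge {v₁, v₂} to T. Then there exist leaves b₁, b₂ of T such that d_G(b₁, b₂) < d_T(b₁, b₂). -/
namespace SimpleGraph

variable {V : Type*} {T : SimpleGraph V}

lemma IsTree.eq_of_adj_of_dist_add_one_eq (hT : T.IsTree) {u v w x : V}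
    (hv : T.Adj u v) (hw : T.Adj u w) (hvx : T.dist v x + 1 = T.dist u x)
    (hwx : T.dist w x + 1 = T.dist u x) : v = w := by
  obtain ⟨p, hp⟩ := hT.connected.exists_walk_length_eq_dist v x
  obtain ⟨q, hq⟩ := hT.connected.exists_walk_length_eq_dist w x
  have hp' := (p.cons hv).isPath_of_length_eq_dist (by simp [hp, hvx])
  have hq' := (q.cons hw).isPath_of_length_eq_dist (by simp [hq, hwx])
  have h := (hT.existsUnique_path u x).unique hp' hq'
  simpa using congrArg Walk.snd h

/-- A vertex of a tree with no neighbor further away from some other vertex `x` is a leaf. -/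
lemma IsTree.degree_eq_one_of_forall_adj_dist_ne (hT : T.IsTree) {u x : V}
    [Fintype (T.neighborSet u)] (hne : u ≠ x)
    (h : ∀ v, T.Adj u v → T.dist v x ≠ T.dist u x + 1) : T.degree u = 1 := by
  have closer : ∀ v, T.Adj u v → T.dist v x + 1 = T.dist u x := fun v hv ↦ by
    have := hT.dist_eq_dist_add_one_of_adj x hv
    rw [T.dist_comm (u := x), T.dist_comm (u := x)] at this
    have := h v hv
    omega
  rw [degree_eq_one_iff_existsUnique_adj]
  have : Nontrivial V := ⟨u, x, hne⟩
  obtain ⟨v, hv⟩ := hT.connected.preconnected.exists_adj_of_nontrivial u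
  exact ⟨v, hv, fun w hw ↦ hT.eq_of_adj_of_dist_add_one_eq hw hv (closer w hw) (closer v hv)⟩

/-- In a finite tree, the geodesic between two distinct vertices extends to a geodesic between
two leaves. -/
lemma IsTree.exists_leaves_dist_add_dist_add_dist_eq [Fintype V] [DecidableRel T.Adj]
    (hT : T.IsTree) {u v : V} (hne : u ≠ v) :
    ∃ a b : V, T.degree a = 1 ∧ T.degree b = 1 ∧
      T.dist a u + T.dist u v + T.dist v b = T.dist a b := by
  classical
  have tri := fun x y z ↦ hT.connected.dist_triangle (u := x) (v := y) (w := z)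
  obtain ⟨⟨a, b⟩, hab, hmax⟩ := Finset.exists_max_image
    (Finset.univ.filter fun p : V × V ↦
      T.dist p.1 u + T.dist u v + T.dist v p.2 = T.dist p.1 p.2)
    (fun p ↦ T.dist p.1 p.2) ⟨(u, v), by simp⟩
  simp only [Finset.mem_filter, Finset.mem_univ, true_and, Prod.forall] at hab hmax
  have hpos := hT.connected.pos_dist_of_ne hne
  have hab_ne : a ≠ b := by
    rintro rfl
    rw [dist_self] at hab
    omega
  refine ⟨a, b, hT.degree_eq_one_of_forall_adj_dist_ne hab_ne fun c hc hd ↦ ?_,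
    hT.degree_eq_one_of_forall_adj_dist_ne hab_ne.symm fun c hc hd ↦ ?_, hab⟩
  · have h1 := dist_eq_one_iff_adj.2 hc.symm
    have := tri c a u
    have := tri c u b
    have := tri u v b
    have := hmax c b (by omega)
    omega
  · have h1 := dist_eq_one_iff_adj.2 hc
    rw [T.dist_comm (u := c), T.dist_comm (u := b)] at hd
    have := tri v b c
    have := tri a u c
    have := tri u v c
    have := hmax a c (by omega)
    omega

end SimpleGraph

/-- Adding an edge to a finite tree (between distinct non-adjacent vertices) strictly
decreases at least one leaf-to-leaf distance. -/
theorem addEdge_decreases_leaf_dist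
    {X : Type*} [Fintype X]
    (T : SimpleGraph X) [DecidableRel T.Adj] (hT : T.IsTree)
    (hcard : 2 ≤ Fintype.card X)
    (v₁ v₂ : X) (hne : v₁ ≠ v₂) (hnadj : ¬ T.Adj v₁ v₂)
    (G : SimpleGraph X) (hG : G = T ⊔ SimpleGraph.fromEdgeSet {s(v₁, v₂)}) :
    ∃ b₁ b₂ : X, T.degree b₁ = 1 ∧ T.degree b₂ = 1 ∧
      G.dist b₁ b₂ < T.dist b₁ b₂ := by
  obtain ⟨b₁, b₂, h₁, h₂, hd⟩ := hT.exists_leaves_dist_add_dist_add_dist_eq hne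
  refine ⟨b₁, b₂, h₁, h₂, ?_⟩
  have hle : T ≤ G := hG ▸ le_sup_left
  have hGc : G.Connected := hT.connected.mono hle
  have hadj : G.dist v₁ v₂ = 1 := SimpleGraph.dist_eq_one_iff_adj.2 (by simp [hG, hne])
  have := hT.connected.one_lt_dist_of_ne_of_not_adj hne hnadj
  have := (hT.connected b₁ v₁).dist_anti hle
  have := (hT.connected v₂ b₂).dist_anti hle
  have := hGc.dist_triangle (u := b₁) (v := v₁) (w := b₂)
  have := hGc.dist_triangle (u := v₁) (v := v₂) (w := b₂)
  omega
end

section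
/- Let F be a Boolean formula in conjunctive normal form over variables u₁, …, u_N with clauses C₁, …, C_M, each clause being a nonempty set of literals (each literal is a variable u_j or a negated variable ū_j). Construct from F the following data: the vertex set X consists of a vertex TRUE, vertices u_j, a_j, ā_j, ū_j for j = 1, …, N, and vertices C_i for i = 1, …, M; the allowed edge set E₁ consists of the edges {TRUE, u_j}, {TRUE, ū_j}, {u_j, a_j}, {a_j, ā_j}, {ā_j, ū_j} for all j = 1, …, N, the edges {a_j, C_i} for all i, j such that the literal u_j appears in clause C_i, and the edges {ā_j, C_i} for all i, j such that the literal ū_j appears in clause C_i. Then the following are equivalent: (i) there exists a truth assignment of the variables under which every clause of F contains a true literal; (ii) there exists an edge set E ⊆ E₁ such that in the simple graph (X, E) one has d_E(u_j, ū_j) = 3 for every j = 1, …, N and d_E(TRUE, C_i) = 3 for every i = 1, …, M. -/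
/-- The vertex set of the graph constructed from a CNF formula with `N` variables
and `M` clauses: a vertex `TRUE`, vertices `u_j`, `a_j`, `ā_j`, `ū_j` for each
variable index `j`, and a vertex `C_i` for each clause index `i`. -/
inductive SatVertex (N M : ℕ) : Type
  | tru : SatVertex N M
  | u : Fin N → SatVertex N M
  | a : Fin N → SatVertex N M
  | abar : Fin N → SatVertex N M
  | ubar : Fin N → SatVertex N M
  | clause : Fin M → SatVertex N M

/-- The relation generating the allowed edge set `E₁`: edges `{TRUE, u_j}`,
`{TRUE, ū_j}`, `{u_j, a_j}`, `{a_j, ā_j}`, `{ā_j, ū_j}` for all `j`; edges `{a_j, C_i}`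
whenever the literal `u_j` appears in clause `C_i`; and edges `{ā_j, C_i}` whenever the
literal `ū_j` appears in clause `C_i`.  (A clause is a finite set of literals, a literal
being a pair `(j, b)` with `b = true` for `u_j` and `b = false` for `ū_j`.) -/
def satAllowed {N M : ℕ} (clauses : Fin M → Finset (Fin N × Bool)) :
    SatVertex N M → SatVertex N M → Prop := fun x y =>
  match x, y with
  | .tru, .u _ => True
  | .tru, .ubar _ => True
  | .u j, .a k => j = k
  | .a j, .abar k => j = k
  | .abar j, .ubar k => j = k
  | .a j, .clause i => (j, true) ∈ clauses i
  | .abar j, .clause i => (j, false) ∈ clauses i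
  | _, _ => False

/-- Two vertices are at distance `3` exactly when they are joined by a walk of length `3`
and are distinct, nonadjacent, and without a common neighbour. -/
theorem SimpleGraph.edist_eq_three_iff {V : Type*} (G : SimpleGraph V) (x y : V) :
    G.edist x y = 3 ↔
      (∃ p q, G.Adj x p ∧ G.Adj p q ∧ G.Adj q y) ∧
        x ≠ y ∧ ¬ G.Adj x y ∧ ∀ z, G.Adj x z → ¬ G.Adj z y := by
  constructor
  · intro h
    have lower : ∀ w : G.Walk x y, 3 ≤ w.length := fun w => by
      have := SimpleGraph.edist_le w
      rw [h] at this
      exact_mod_cast this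
    refine ⟨?_, ?_, ?_, ?_⟩
    · obtain ⟨w, hw⟩ := SimpleGraph.exists_walk_of_edist_ne_top (G := G) (u := x) (v := y)
        (by rw [h]; exact ENat.natCast_ne_top 3)
      rw [h] at hw
      have hw : w.length = 3 := by exact_mod_cast hw
      match w, hw with
      | .cons hp (.cons hq (.cons hy .nil)), _ => exact ⟨_, _, hp, hq, hy⟩
    · rintro rfl
      simpa using lower .nil
    · intro hxy
      simpa using lower (.cons hxy .nil)
    · intro z hxz hzy
      simpa using lower (.cons hxz (.cons hzy .nil))
  · rintro ⟨⟨p, q, hp, hq, hy⟩, hne, hadj, hcommon⟩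
    apply le_antisymm
    · simpa using SimpleGraph.edist_le (.cons hp (.cons hq (.cons hy .nil)) : G.Walk x y)
    · refine le_iInf fun w => ?_
      suffices 3 ≤ w.length by exact_mod_cast this
      match w with
      | .nil => exact absurd rfl hne
      | .cons h .nil => exact absurd h hadj
      | .cons h (.cons h' .nil) => exact absurd h' (hcommon _ h)
      | .cons _ (.cons _ (.cons _ _)) => simp [SimpleGraph.Walk.length_cons]

/-- The edges that may be kept under the truth assignment `v`: `TRUE` is joined only to
the true literals. -/
def satKept {N M : ℕ} (v : Fin N → Bool) : SatVertex N M → SatVertex N M → Prop := fun x y =>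
  match x, y with
  | .tru, .u j => v j = true
  | .tru, .ubar j => v j = false
  | _, _ => True

/-- The solution of the inverse problem given by the truth assignment `v`. -/
def satGraph {N M : ℕ} (clauses : Fin M → Finset (Fin N × Bool)) (v : Fin N → Bool) :
    SimpleGraph (SatVertex N M) :=
  SimpleGraph.fromRel fun x y => satAllowed clauses x y ∧ satKept v x y

/-- A CNF formula `F` (with every clause nonempty) is satisfiable if and only if the
instance of the restricted inverse travel time problem constructed from `F` has a
solution, i.e., there is an edge set `E ⊆ E₁` such that in the graph `(X, E)` the
distance from `u_j` to `ū_j` is `3` for every `j`, and the distance from `TRUE` to `C_i`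
is `3` for every `i`. -/
theorem sat_iff_restricted_inverse_travel_time
    {N M : ℕ} (clauses : Fin M → Finset (Fin N × Bool))
    (hne : ∀ i, (clauses i).Nonempty) :
    (∃ v : Fin N → Bool, ∀ i, ∃ l ∈ clauses i, v l.1 = l.2) ↔
    (∃ G : SimpleGraph (SatVertex N M),
      G ≤ SimpleGraph.fromRel (satAllowed clauses) ∧
      (∀ j : Fin N, G.edist (.u j) (.ubar j) = 3) ∧
      (∀ i : Fin M, G.edist .tru (.clause i) = 3)) := by
  simp only [SimpleGraph.edist_eq_three_iff]
  constructor
  · rintro ⟨v, hv⟩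
    refine ⟨satGraph clauses v, ?_, fun j => ⟨?_, ?_, ?_, ?_⟩, fun i => ⟨?_, ?_, ?_, ?_⟩⟩
    · intro x y h
      simp only [satGraph, SimpleGraph.fromRel_adj] at h ⊢
      tauto
    · exact ⟨.a j, .abar j, by simp [satGraph, satAllowed, satKept]⟩
    · simp
    · simp [satGraph, satAllowed]
    · intro z
      cases z <;> simp [satGraph, satAllowed, satKept]
    · obtain ⟨⟨j, b⟩, hmem, hval⟩ := hv i
      cases b
      · exact ⟨.ubar j, .abar j, by simp_all [satGraph, satAllowed, satKept]⟩
      · exact ⟨.u j, .a j, by simp_all [satGraph, satAllowed, satKept]⟩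
    · simp
    · simp [satGraph, satAllowed]
    · intro z
      cases z <;> simp [satGraph, satAllowed]
  · rintro ⟨G, hG, hvar, hclause⟩
    classical
    refine ⟨fun j => decide (G.Adj .tru (.u j)), fun i => ?_⟩
    obtain ⟨⟨p, q, hp, hq, hy⟩, -⟩ := hclause i
    have hp' := hG hp
    have hq' := hG hq
    have hy' := hG hy
    rw [SimpleGraph.fromRel_adj] at hp' hq' hy'
    cases p <;> simp [satAllowed] at hp' <;> cases q <;> simp [satAllowed] at hq' hy'
    case u.a j k =>
      subst hq'
      exact ⟨(j, true), hy', by simpa using hp⟩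
    case ubar.abar j k =>
      subst hq'
      exact ⟨(k, false), hy', by simpa using fun h => (hvar k).2.2.2 .tru h.symm hp⟩
end

section
/- Define L(θ) for θ ∈ (0, π/2) by: L(θ) = ⌈π/(4θ) − 1/2⌉ if 0 < θ < π/8, L(θ) = 1 if π/8 ≤ θ < π/4, and L(θ) = 0 if π/4 ≤ θ < π/2. Then for every θ ∈ (0, π/2), one has π/4 ≤ (2·L(θ)+1)·θ < 3π/4; consequently sin²((2·L(θ)+1)·θ) ≥ 1/2. -/
/-- The number of Grover iterations chosen for the angle `θ`. -/
noncomputable def groverL (θ : ℝ) : ℕ :=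
  if θ < Real.pi / 8 then ⌈Real.pi / (4 * θ) - 1 / 2⌉₊
  else if θ < Real.pi / 4 then 1
  else 0

theorem half_le_sin_sq {x : ℝ} (h₁ : Real.pi / 4 ≤ x) (h₂ : x ≤ 3 * Real.pi / 4) :
    (1 : ℝ) / 2 ≤ Real.sin x ^ 2 := by
  have hcos : Real.cos (2 * x) ≤ 0 :=
    Real.cos_nonpos_of_pi_div_two_le_of_le (by linarith) (by linarith)
  rw [Real.sin_sq_eq_half_sub]
  linarith

/-- For every `θ ∈ (0, π/2)` one has `π/4 ≤ (2·L(θ)+1)·θ < 3π/4`; consequently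
`sin²((2·L(θ)+1)·θ) ≥ 1/2`. -/
theorem groverL_angle_bounds (θ : ℝ) (hθ : θ ∈ Set.Ioo 0 (Real.pi / 2)) :
    Real.pi / 4 ≤ (2 * (groverL θ : ℝ) + 1) * θ ∧
    (2 * (groverL θ : ℝ) + 1) * θ < 3 * Real.pi / 4 ∧
    (1 : ℝ) / 2 ≤ Real.sin ((2 * (groverL θ : ℝ) + 1) * θ) ^ 2 := by
  obtain ⟨h0, h2⟩ := hθ
  have hbounds : Real.pi / 4 ≤ (2 * (groverL θ : ℝ) + 1) * θ ∧
      (2 * (groverL θ : ℝ) + 1) * θ < 3 * Real.pi / 4 := by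
    unfold groverL
    split_ifs with h8 h4
    · have hdiv : Real.pi / (4 * θ) * θ = Real.pi / 4 := by field_simp
      have hx : 0 ≤ Real.pi / (4 * θ) - 1 / 2 := by
        rw [sub_nonneg, le_div_iff₀ (by positivity)]
        linarith
      have hle := mul_le_mul_of_nonneg_right (Nat.le_ceil (Real.pi / (4 * θ) - 1 / 2)) h0.le
      have hlt := mul_lt_mul_of_pos_right (Nat.ceil_lt_add_one hx) h0
      constructor <;> linarith [Real.pi_pos]
    · push_cast
      constructor <;> linarith
    · push_cast
      constructor <;> linarith
  exact ⟨hbounds.1, hbounds.2, half_le_sin_sq hbounds.1 hbounds.2.le⟩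
end

section
/- If θ ∈ (0, π/2) satisfies sin θ ≥ 1/4, then at least one of the three numbers θ, 3θ, 5θ lies in the closed interval [π/4, 3π/4]. -/
/-- If `θ ∈ (0, π/2)` satisfies `sin θ ≥ 1/4`, then at least one of `θ`, `3θ`, `5θ` lies
in the closed interval `[π/4, 3π/4]`. -/
theorem one_of_three_angles_in_interval (θ : ℝ) (hθ : θ ∈ Set.Ioo 0 (Real.pi / 2))
    (hsin : 1 / 4 ≤ Real.sin θ) :
    θ ∈ Set.Icc (Real.pi / 4) (3 * Real.pi / 4) ∨
    3 * θ ∈ Set.Icc (Real.pi / 4) (3 * Real.pi / 4) ∨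
    5 * θ ∈ Set.Icc (Real.pi / 4) (3 * Real.pi / 4) := by
  obtain ⟨h0, h1⟩ := hθ
  have hlt : Real.sin θ < θ := Real.sin_lt h0
  have hpi : Real.pi < 4 := Real.pi_lt_four
  rcases le_or_gt (Real.pi / 4) θ with h | h
  · exact Or.inl ⟨h, by linarith⟩
  · rcases le_or_gt (Real.pi / 12) θ with h' | h'
    · exact Or.inr (Or.inl ⟨by linarith, by linarith⟩)
    · exact Or.inr (Or.inr ⟨by linarith, by linarith⟩)
end
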